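/- arXiv:1702.08149 — 4 statements merged into one kernel-verified Lean document; each statement's English description precedes it below -/
import Mathlib

section
/- Let F be a field with a nontrivial involution c and let n ≥ 2. An element g ∈ GL_n(F) is c-real (i.e. g is conjugate in GL_n(F) to (g^c)^{-1}) if and only if there exists a nondegenerate c-hermitian matrix H ∈ M_n(F) such that (g^c)^t H g = H (i.e. g lies in the unitary group of some nondegenerate c-hermitian form of dimension n over F). -/
open Matrix

lemma fitting {F : Type*} [Field F] {n : ℕ} (T : Matrix (Fin n) (Fin n) F) :
    ∃ (N : ℕ) (z f : Matrix (Fin n) (Fin n) F), (∀ B, Commute B T → Commute B z) ∧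
      f = T ^ (N + 1) * z ∧ f * T ^ (N + 1) = T ^ (N + 1) := by
  obtain ⟨q, hq, hnd⟩ := Polynomial.exists_eq_pow_rootMultiplicity_mul_and_not_dvd
    T.charpoly T.charpoly_monic.ne_zero 0
  set N := T.charpoly.rootMultiplicity 0
  simp only [map_zero, sub_zero] at hq hnd
  have hco : IsCoprime ((Polynomial.X : Polynomial F) ^ (N + 1)) q :=
    IsCoprime.pow_left ((Polynomial.irreducible_X.coprime_iff_not_dvd).2 hnd)
  obtain ⟨u, v, huv⟩ := hco
  have hcom : ∀ p : Polynomial F, ∀ B, Commute B T → Commute B (Polynomial.aeval T p) := by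
    intro p B hB
    induction p using Polynomial.induction_on' with
    | add p q hp hq => rw [map_add]; exact hp.add_right hq
    | monomial k r =>
      rw [Polynomial.aeval_monomial]
      exact (show Commute _ _ from (Algebra.commutes r B).symm).mul_right (hB.pow_right k)
  refine ⟨N, Polynomial.aeval T u, T ^ (N + 1) * Polynomial.aeval T u, fun B hB => hcom u B hB, rfl, ?_⟩
  have h1 := congrArg (Polynomial.aeval T) huv
  have h2 := congrArg (Polynomial.aeval T) hq
  rw [Matrix.aeval_self_charpoly] at h2
  simp only [map_add, map_mul, map_pow, Polynomial.aeval_X, map_one] at h1 h2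
  have c1 : Commute (T ^ (N + 1)) (Polynomial.aeval T u) := hcom u _ ((Commute.refl T).pow_left (N + 1))
  have c2 : Commute (T ^ (N + 1)) (Polynomial.aeval T v) := hcom v _ ((Commute.refl T).pow_left (N + 1))
  have c3 : Commute (T ^ (N + 1)) (Polynomial.aeval T q) := hcom q _ ((Commute.refl T).pow_left (N + 1))
  have h3 := congrArg (· * T ^ (N + 1)) h1
  simp only [add_mul, one_mul] at h3
  rw [mul_assoc (Polynomial.aeval T v), ← c3.eq, pow_succ' T N, mul_assoc T, ← h2, mul_zero, mul_zero,
    add_zero, ← pow_succ' T N, ← c1.eq] at h3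
  exact h3

lemma main_aux {F : Type*} [Field F] [StarRing F] (a : F) (ha : star a ≠ a) {n : ℕ}
    (S g : Matrix (Fin n) (Fin n) F) (hS : IsUnit S) (hg : IsUnit g) (h : gᴴ * S * g = S) :
    ∃ H : Matrix (Fin n) (Fin n) F, IsUnit H ∧ Hᴴ = H ∧ gᴴ * H * g = H := by
  have hSd : IsUnit S.det := (Matrix.isUnit_iff_isUnit_det S).1 hS
  have hSH : IsUnit Sᴴ := hS.star
  have hSHd : IsUnit Sᴴ.det := (Matrix.isUnit_iff_isUnit_det _).1 hSH
  have hgH : IsUnit gᴴ := hg.star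
  obtain ⟨A, hA⟩ : ∃ A, A = S⁻¹ * Sᴴ := ⟨_, rfl⟩
  obtain ⟨Ai, hAi⟩ : ∃ A, A = Sᴴ⁻¹ * S := ⟨_, rfl⟩
  have hSA : S * A = Sᴴ := by rw [hA, Matrix.mul_nonsing_inv_cancel_left _ _ hSd]
  have hSAi : Sᴴ * Ai = S := by rw [hAi, Matrix.mul_nonsing_inv_cancel_left _ _ hSHd]
  have hAAi : A * Ai = 1 := by
    rw [hA, mul_assoc, hSAi, Matrix.nonsing_inv_mul _ hSd]
  have hAiA : Ai * A = 1 := by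
    rw [hAi, mul_assoc, hSA, Matrix.nonsing_inv_mul _ hSHd]
  have hAS : Aᴴ * S = S * Ai := by
    have h1 : Aᴴ * Sᴴ = S := by
      rw [← conjTranspose_mul, hSA, conjTranspose_conjTranspose]
    calc Aᴴ * S = Aᴴ * (Sᴴ * Ai) := by rw [hSAi]
      _ = _ := by rw [← mul_assoc, h1]
  have hAiS : Aiᴴ * S = S * A := by
    have h1 : Aiᴴ * S = Sᴴ := by
      rw [← hSAi, conjTranspose_mul, conjTranspose_conjTranspose, hSAi]
    rw [h1, hSA]
  have h' : gᴴ * Sᴴ * g = Sᴴ := by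
    have := congrArg conjTranspose h
    simpa [conjTranspose_mul, mul_assoc] using this
  have hAg : Commute g A := by
    have : (gᴴ * S) * (g * A) = (gᴴ * S) * (A * g) := by
      rw [← mul_assoc, h, hSA, mul_assoc gᴴ, ← mul_assoc S, hSA, ← mul_assoc, h']
    exact (hgH.mul hS).mul_left_cancel this
  have cAAi : Commute A Ai := by rw [Commute, SemiconjBy, hAAi, hAiA]
  have hAig : Commute g Ai := by
    calc g * Ai = Ai * A * g * Ai := by rw [hAiA, one_mul]
      _ = Ai * g * (A * Ai) := by rw [mul_assoc Ai, ← hAg.eq]; simp only [mul_assoc]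
      _ = Ai * g := by rw [hAAi, mul_one]
  obtain ⟨T, hT⟩ : ∃ T, T = (1 + A) * (1 + Ai) := ⟨_, rfl⟩
  have cT : ∀ B, Commute B A → Commute B Ai → Commute B T := by
    intro B h1 h2
    rw [hT]
    exact ((Commute.one_right B).add_right h1).mul_right ((Commute.one_right B).add_right h2)
  have hTS : Tᴴ * S = S * T := by
    rw [hT, conjTranspose_mul, conjTranspose_add, conjTranspose_add, conjTranspose_one]
    rw [mul_assoc, add_mul _ _ S, hAS, one_mul]
    have : (1 + Aiᴴ) * S = S * (1 + A) := by rw [add_mul, hAiS, one_mul, mul_add, mul_one]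
    rw [show S + S * Ai = S * (1 + Ai) by rw [mul_add, mul_one], ← mul_assoc, this, mul_assoc]
  obtain ⟨M, z, f, hz, hf, hfT⟩ := fitting T
  obtain ⟨N, hN⟩ : ∃ N, N = M + 1 := ⟨_, rfl⟩
  rw [← hN] at hf hfT
  have cz : ∀ B, Commute B A → Commute B Ai → Commute B f := by
    intro B h1 h2
    rw [hf]
    exact ((cT B h1 h2).pow_right N).mul_right (hz B (cT B h1 h2))
  have cAf := cz A (Commute.refl A) cAAi
  have cgf := cz g hAg hAig
  -- f is fixed by the involution
  have hTNS : (T ^ N)ᴴ * S = S * T ^ N := by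
    rw [conjTranspose_pow]
    have : SemiconjBy S T Tᴴ := hTS.symm
    exact (this.pow_right N).eq.symm
  obtain ⟨sz, hsz⟩ : ∃ sz, sz = S⁻¹ * zᴴ * S := ⟨_, rfl⟩
  have hszS : zᴴ * S = S * sz := by
    rw [hsz, mul_assoc, Matrix.mul_nonsing_inv_cancel_left _ _ hSd]
  have cTz : Commute T z := hz T (Commute.refl T)
  have cTNz : Commute (T ^ N) z := cTz.pow_left N
  have hfS0 : fᴴ * S = S * (T ^ N * sz) := by
    have : f = z * T ^ N := by rw [hf, cTNz.eq]
    rw [this, conjTranspose_mul, mul_assoc, hszS, ← mul_assoc, hTNS, mul_assoc]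
  have hfS : fᴴ * S = S * f := by
    have e1 : f * (T ^ N * sz) = T ^ N * sz := by rw [← mul_assoc f, hfT]
    have e2 : T ^ N * (T ^ N * sz) = T ^ N := by
      have h1 : (f * T ^ N)ᴴ * S = (T ^ N)ᴴ * S := by rw [hfT]
      rw [conjTranspose_mul, mul_assoc, hfS0, ← mul_assoc, hTNS, mul_assoc] at h1
      exact hS.mul_left_cancel h1
    have e3 : f * (T ^ N * sz) = f := by
      rw [hf, cTNz.eq, mul_assoc z, e2]
    rw [hfS0, ← e1, e3]
  obtain ⟨w, hw⟩ : ∃ w, w = f * (1 + A) + (1 - f) * (a • 1 + star a • A) :=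
    ⟨_, rfl⟩
  have hgw : Commute g w := by
    rw [hw]
    exact (cgf.mul_right ((Commute.one_right _).add_right hAg)).add_right
      (((Commute.one_right _).sub_right cgf).mul_right
       (((Commute.one_right _).smul_right a).add_right (hAg.smul_right (star a))))
  have hwS : wᴴ * (S * A) = S * w := by
    have h1 : (f * (1 + A))ᴴ * S = S * ((1 + Ai) * f) := by
      rw [conjTranspose_mul, mul_assoc, hfS, ← mul_assoc, conjTranspose_add, add_mul _ _ S, hAS]
      simp only [conjTranspose_one]
      noncomm_ring
    have h2 : ((1 - f) * (a • 1 + star a • A))ᴴ * S = S * ((star a • 1 + a • Ai) * (1 - f)) := by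
      rw [conjTranspose_mul, mul_assoc, conjTranspose_sub, sub_mul, hfS, conjTranspose_one, one_mul,
        show S - S * f = S * (1 - f) by rw [mul_sub, mul_one], ← mul_assoc, conjTranspose_add,
        conjTranspose_smul, conjTranspose_smul, star_star, add_mul, smul_mul_assoc, smul_mul_assoc,
        hAS, conjTranspose_one, one_mul, ← mul_assoc, mul_add, mul_smul_comm, mul_smul_comm, mul_one]
    have c1 : (1 + Ai) * f * A = f * (1 + A) := by
      rw [mul_assoc, ← cAf.eq, ← mul_assoc, add_mul, hAiA, one_mul, add_comm A 1]
      exact ((Commute.one_left _).add_left cAf).eq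
    have c2 : (star a • 1 + a • Ai) * (1 - f) * A = (1 - f) * (a • 1 + star a • A) := by
      have c3 : Commute A (1 - f) := (Commute.one_right _).sub_right cAf
      rw [mul_assoc, ← c3.eq, ← mul_assoc, add_mul, smul_mul_assoc, smul_mul_assoc, hAiA, one_mul,
        add_comm]
      exact (((Commute.one_left _).smul_left _).add_left (c3.smul_left _)).eq
    rw [← mul_assoc, hw, conjTranspose_add, add_mul _ _ S, h1, h2, add_mul, mul_assoc S,
      mul_assoc S, c1, c2, ← mul_add S]
  have hff : f * f = f := by
    nth_rw 2 [hf]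
    rw [← mul_assoc, hfT, ← hf]
  have hfw : f * w = f * (1 + A) := by
    rw [hw, mul_add, ← mul_assoc, hff, ← mul_assoc, mul_sub, mul_one, hff, sub_self, zero_mul,
      add_zero]
  have cAif := cz Ai cAAi.symm (Commute.refl Ai)
  have cTf : Commute T f := by
    rw [hT]
    exact ((Commute.one_left _).add_left cAf).mul_left ((Commute.one_left _).add_left cAif)
  have cA1 : Commute (1 + A) (1 + Ai) :=
    ((Commute.one_left _).add_left ((Commute.one_right _).add_right cAAi))
  have hfP : f = z * T ^ M * (1 + Ai) * f * w := by
    rw [mul_assoc _ f w, hfw, ← ((Commute.one_left f).add_left cAf).eq, mul_assoc _ (1 + Ai),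
      ← mul_assoc (1 + Ai), ← cA1.eq, ← hT, ← mul_assoc, mul_assoc z, ← pow_succ, ← hN, ← cTNz.eq,
      ← hf, hff]
  have hnil : IsNilpotent ((1 - f) * (1 + A)) := by
    have cA1f : Commute (1 + A) (1 - f) :=
      (Commute.one_right _).sub_right ((Commute.one_left f).add_left cAf)
    have hT1 : IsNilpotent (T * (1 - f)) := by
      refine ⟨N, ?_⟩
      have hc : Commute T (1 - f) := (Commute.one_right _).sub_right cTf
      rw [hc.mul_pow, hN, pow_succ' (1 - f), ← mul_assoc, ← hN, mul_sub, mul_one,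
        (cTf.pow_left N).eq, hfT, sub_self, zero_mul]
    have cAT : Commute A T := cT A (Commute.refl A) cAAi
    have e : ((1 - f) * (1 + A)) ^ 2 = T * (1 - f) * A := by
      have e1 : (1 + Ai) * A = 1 + A := by rw [add_mul, hAiA, one_mul, add_comm]
      have e2 : (1 - f) * (1 - f) = 1 - f := by
        rw [mul_sub, mul_one, sub_mul, one_mul, hff, sub_self, sub_zero]
      have c3 : Commute A (1 - f) := (Commute.one_right _).sub_right cAf
      rw [← cA1f.eq, cA1f.mul_pow, mul_assoc T, ← c3.eq, hT, pow_two (1 - f), e2, mul_assoc (1 + A),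
        ← mul_assoc (1 + Ai), e1, pow_two, mul_assoc]
    have h2 : IsNilpotent (((1 - f) * (1 + A)) ^ 2) := by
      rw [e]
      exact Commute.isNilpotent_mul_right
        (cAT.symm.mul_left ((Commute.one_left _).sub_left cAf.symm)) hT1
    obtain ⟨k, hk⟩ := h2
    exact ⟨2 * k, by rw [pow_mul, hk]⟩
  have hwu : IsUnit w := by
    have hd : a - star a ≠ 0 := sub_ne_zero.2 (Ne.symm ha)
    have e2 : (1 - f) * (1 - f) = 1 - f := by
        rw [mul_sub, mul_one, sub_mul, one_mul, hff, sub_self, sub_zero]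
    have e3 : (1 - f) * f = 0 := by rw [sub_mul, one_mul, hff, sub_self]
    have e4 : f * (1 - f) = 0 := by rw [mul_sub, mul_one, hff, sub_self]
    have hu1 : IsUnit (f + (a - star a) • (1 - f)) := by
      refine IsUnit.of_mul_eq_one (f + (a - star a)⁻¹ • (1 - f)) ?_
      simp only [mul_add, add_mul, smul_mul_assoc, mul_smul_comm, hff, e2, e3, e4, smul_zero,
        add_zero, zero_add]
      rw [smul_smul, inv_mul_cancel₀ hd, one_smul, add_sub_cancel]
    have hcomm : Commute (f + (a - star a) • (1 - f)) (star a • ((1 - f) * (1 + A))) := by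
      have c1 : Commute f ((1 - f) * (1 + A)) :=
        ((Commute.one_right _).sub_right (Commute.refl f)).mul_right
          ((Commute.one_right _).add_right cAf.symm)
      exact (c1.add_left (((Commute.one_left _).sub_left c1).smul_left _)).smul_right _
    have hu2 : IsUnit (star a • ((1 - f) * (1 + A)) + (f + (a - star a) • (1 - f))) :=
      (hnil.smul (star a)).isUnit_add_right_of_commute hu1 hcomm.symm
    have e5 : star a • ((1 - f) * (1 + A)) + (f + (a - star a) • (1 - f)) =
        (z * T ^ M * (1 + Ai) * f + (1 - f)) * w := by
      rw [add_mul, ← hfP, hw, mul_add (1 - f) (f * (1 + A)), ← mul_assoc, e3, zero_mul, zero_add, ← mul_assoc, e2,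
        mul_add, mul_add, mul_smul_comm, mul_smul_comm, mul_one, sub_smul, smul_add]
      abel
    rw [e5] at hu2
    rw [Matrix.isUnit_iff_isUnit_det, det_mul] at hu2
    exact (Matrix.isUnit_iff_isUnit_det _).2 (isUnit_of_mul_isUnit_right hu2)
  refine ⟨S * w, hS.mul hwu, ?_, ?_⟩
  · rw [conjTranspose_mul, ← hSA, hwS]
  · rw [mul_assoc, mul_assoc, ← hgw.eq, ← mul_assoc S, ← mul_assoc, ← mul_assoc, h]

open Polynomial in
lemma exists_functional {F : Type*} [Field F] (q : F[X]) (hq : q ≠ 0) :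
    ∃ l : (F[X] ⧸ Ideal.span {q}) →ₗ[F] F, ∀ u, u ≠ 0 → ∃ v, l (u * v) ≠ 0 := by
  classical
  have key : ∀ q : F[X], q.Monic → 
    ∃ l : AdjoinRoot q →ₗ[F] F, ∀ u, u ≠ 0 → ∃ v, l (u * v) ≠ 0 := by
    intro q hm
    refine ⟨(Polynomial.lcoeff F (q.natDegree - 1)).comp (AdjoinRoot.modByMonicHom hm), ?_⟩
    intro u hu
    set r := AdjoinRoot.modByMonicHom hm u with hr
    have hru : AdjoinRoot.mk q r = u := AdjoinRoot.mk_leftInverse hm u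
    have hr0 : r ≠ 0 := by rintro h; rw [h, map_zero] at hru; exact hu hru.symm
    have hdeg : r.degree < q.degree := by
      have : r = r %ₘ q := by
        rw [← AdjoinRoot.modByMonicHom_mk hm, hru]
      rw [this]; exact degree_modByMonic_lt _ hm
    have hnd : r.natDegree < q.natDegree := natDegree_lt_natDegree hr0 hdeg
    refine ⟨AdjoinRoot.mk q (X ^ (q.natDegree - 1 - r.natDegree)), ?_⟩
    rw [← hru, ← map_mul, LinearMap.comp_apply, AdjoinRoot.modByMonicHom_mk,
      (modByMonic_eq_self_iff hm).2, lcoeff_apply]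
    · have : q.natDegree - 1 = r.natDegree + (q.natDegree - 1 - r.natDegree) := by omega
      nth_rw 2 [this]
      rw [coeff_mul_X_pow]
      simpa using hr0
    · apply degree_lt_degree
      rw [natDegree_mul_X_pow _ hr0]
      omega
  have hs : Ideal.span {q} = Ideal.span {normalize q} :=
    Ideal.span_singleton_eq_span_singleton.2 (normalize_associated q).symm
  rw [hs]
  exact key _ (monic_normalize hq)

open Polynomial in
lemma transpose_similar {F : Type*} [Field F] {n : ℕ} (g : Matrix (Fin n) (Fin n) F) :
    ∃ J : Matrix (Fin n) (Fin n) F, IsUnit J ∧ gᵀ * J = J * g := by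
  classical
  have htor : Module.IsTorsion F[X] (Module.AEval' (Matrix.toLin' g)) := by
    intro x
    refine ⟨⟨g.charpoly, mem_nonZeroDivisors_of_ne_zero g.charpoly_monic.ne_zero⟩, ?_⟩
    obtain ⟨y, rfl⟩ := (Module.AEval'.of (Matrix.toLin' g)).surjective x
    have h0 : aeval (Matrix.toLin' g) g.charpoly = 0 := by
      have := LinearMap.aeval_self_charpoly (Matrix.toLin' g)
      rwa [Matrix.charpoly_toLin'] at this
    change (g.charpoly : F[X]) • (Module.AEval'.of (Matrix.toLin' g)) y = 0
    rw [← Module.AEval.of_aeval_smul, h0, zero_smul, map_zero]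
  obtain ⟨ι, _, p, hp, e, ⟨E⟩⟩ := Module.equiv_directSum_of_isTorsion htor
  choose l hl using fun i => exists_functional (p i ^ e i) (pow_ne_zero _ (hp i).ne_zero)
  -- coordinates
  let co : ∀ i, (Fin n → F) →ₗ[F] (F[X] ⧸ Ideal.span {p i ^ e i}) := fun i =>
    ((DirectSum.component F[X] ι (fun i => F[X] ⧸ Ideal.span {p i ^ e i}) i).restrictScalars F) ∘ₗ
      (E.toLinearMap.restrictScalars F) ∘ₗ (Module.AEval'.of (Matrix.toLin' g)).toLinearMap
  have hco : ∀ i v, co i (g *ᵥ v) = Ideal.Quotient.mk _ X * co i v := by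
    intro i v
    have h1 : Module.AEval'.of (Matrix.toLin' g) (g *ᵥ v) =
        (X : F[X]) • Module.AEval'.of (Matrix.toLin' g) v := by
      rw [Module.AEval'.X_smul_of, Matrix.toLin'_apply]
    change DirectSum.component F[X] ι (fun i => F[X] ⧸ Ideal.span {p i ^ e i}) i
      (E (Module.AEval'.of (Matrix.toLin' g) (g *ᵥ v))) = _
    rw [h1, map_smul, map_smul]
    rfl
  have hco' : ∀ x : (∀ i, F[X] ⧸ Ideal.span {p i ^ e i}), ∃ v, ∀ i, co i v = x i := by
    intro x
    refine ⟨(Module.AEval'.of (Matrix.toLin' g)).symm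
      (E.symm (DFinsupp.equivFunOnFintype.symm x)), fun i => ?_⟩
    change DirectSum.component F[X] ι (fun i => F[X] ⧸ Ideal.span {p i ^ e i}) i
      (E (Module.AEval'.of (Matrix.toLin' g) _)) = _
    rw [LinearEquiv.apply_symm_apply, LinearEquiv.apply_symm_apply]
    rfl
  have hinj : ∀ v, (∀ i, co i v = 0) → v = 0 := by
    intro v hv
    have h1 : E (Module.AEval'.of (Matrix.toLin' g) v) = 0 := DFinsupp.ext fun i => hv i
    simpa using h1
  let B : (Fin n → F) →ₗ[F] (Fin n → F) →ₗ[F] F :=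
    ∑ i, ((LinearMap.mul F (F[X] ⧸ Ideal.span {p i ^ e i})).compr₂ (l i)).compl₁₂ (co i) (co i)
  have hB : ∀ u v, B u v = ∑ i, l i (co i u * co i v) := by
    intro u v
    simp [B, LinearMap.sum_apply]
  have hBg : ∀ u v, B (g *ᵥ u) v = B u (g *ᵥ v) := by
    intro u v
    simp only [hB, hco]
    refine Finset.sum_congr rfl fun i _ => ?_
    congr 1; ring
  have hBn : ∀ u, (∀ v, B v u = 0) → u = 0 := by
    intro u hu
    apply hinj
    intro i
    by_contra hne
    obtain ⟨x, hx⟩ := hl i _ hne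
    obtain ⟨v, hv⟩ := hco' (Pi.single i x)
    apply hx
    have := hu v
    rw [hB, Finset.sum_eq_single i] at this
    · rw [hv] at this; simpa [mul_comm] using this
    · intro j _ hj
      rw [hv, Pi.single_eq_of_ne hj, zero_mul, map_zero]
    · simp
  have hJ : ∀ u v, B u v = u ⬝ᵥ (LinearMap.toMatrix₂' F B *ᵥ v) := by
    intro u v
    rw [← Matrix.toLinearMap₂'_apply', Matrix.toLinearMap₂'_toMatrix']
  refine ⟨LinearMap.toMatrix₂' F B, ?_, ?_⟩
  · rw [← Matrix.mulVec_injective_iff_isUnit]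
    intro u v huv
    have : u - v = 0 := by
      apply hBn
      intro w
      rw [hJ, mulVec_sub, huv, sub_self, dotProduct_zero]
    exact sub_eq_zero.1 this
  · have : ∀ u v, u ⬝ᵥ ((gᵀ * LinearMap.toMatrix₂' F B) *ᵥ v) = u ⬝ᵥ ((LinearMap.toMatrix₂' F B * g) *ᵥ v) := by
      intro u v
      rw [← mulVec_mulVec, ← mulVec_mulVec, ← hJ, ← hBg, hJ, dotProduct_mulVec u gᵀ, vecMul_transpose]
    ext i j
    have := this (Pi.single i 1) (Pi.single j 1)
    simpa using this

/-- Let `F` be a field with a nontrivial involution `c` and `n ≥ 2`.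
An element `g ∈ GL_n(F)` is `c`-real (conjugate in `GL_n(F)` to `(g^c)⁻¹`) iff there
exists a nondegenerate `c`-hermitian matrix `H` with `(g^c)ᵀ * H * g = H`. -/
theorem c_real_iff_unitary_rep
    {F : Type*} [Field F] (c : F →+* F) (hc : ∀ x, c (c x) = x)
    (hnt : ∃ x : F, c x ≠ x) (n : ℕ) (hn : 2 ≤ n)
    (g : Matrix (Fin n) (Fin n) F) (hg : IsUnit g) :
    (∃ S : Matrix (Fin n) (Fin n) F, IsUnit S ∧ S * g * S⁻¹ = (g.map c)⁻¹) ↔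
      (∃ H : Matrix (Fin n) (Fin n) F, IsUnit H ∧ Hᵀ = H.map c ∧
        (g.map c)ᵀ * H * g = H) := by
  letI : StarRing F :=
    { star := c
      star_involutive := hc
      star_mul := fun x y => by rw [map_mul, mul_comm]
      star_add := fun x y => map_add c x y }
  have hgc : IsUnit (g.map c) := hg.map c.mapMatrix
  have hgcd : IsUnit (g.map c).det := (Matrix.isUnit_iff_isUnit_det _).1 hgc
  obtain ⟨J, hJ, hJg⟩ := transpose_similar (g.map c)
  have hJd : IsUnit J.det := (Matrix.isUnit_iff_isUnit_det _).1 hJ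
  have hconj : ∀ M : Matrix (Fin n) (Fin n) F, Mᴴ = (M.map c)ᵀ := fun M => rfl
  constructor
  · rintro ⟨S, hS, hSg⟩
    have hSd : IsUnit S.det := (Matrix.isUnit_iff_isUnit_det _).1 hS
    have h1 : g.map c * (S * g) = S := by
      have : S * g = (g.map c)⁻¹ * S := by
        rw [← hSg, Matrix.nonsing_inv_mul_cancel_right _ _ hSd]
      rw [this, Matrix.mul_nonsing_inv_cancel_left _ _ hgcd]
    obtain ⟨a, ha⟩ := hnt
    obtain ⟨H, hH, hHH, hHg⟩ := main_aux a ha (J * S) g (hJ.mul hS) hg (by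
      rw [hconj, ← mul_assoc, hJg, mul_assoc, mul_assoc, h1])
    refine ⟨H, hH, ?_, hHg⟩
    rw [hconj] at hHH
    conv_lhs => rw [← hHH]
    rw [transpose_transpose]
  · rintro ⟨H, hH, -, hHg⟩
    have hS : IsUnit (J⁻¹ * H) := by
      refine IsUnit.mul ?_ hH
      exact (Matrix.isUnit_nonsing_inv_iff).2 hJ
    have hSd : IsUnit (J⁻¹ * H).det := (Matrix.isUnit_iff_isUnit_det _).1 hS
    refine ⟨J⁻¹ * H, hS, ?_⟩
    have h1 : g.map c * (J⁻¹ * H * g) = J⁻¹ * H := by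
      apply hJ.mul_left_cancel
      rw [← mul_assoc, ← hJg, Matrix.mul_nonsing_inv_cancel_left _ _ hJd, mul_assoc _ J,
        mul_assoc J⁻¹, Matrix.mul_nonsing_inv_cancel_left _ _ hJd, ← mul_assoc, hHg]
    have h2 : J⁻¹ * H * g = (g.map c)⁻¹ * (J⁻¹ * H) := by
      rw [← h1, Matrix.nonsing_inv_mul_cancel_left _ _ hgcd, h1]
    rw [h2, Matrix.mul_nonsing_inv_cancel_right _ _ hSd]
end

section
/- Let F be a field with a nontrivial involution c, let V be an F-vector space of finite dimension n ≥ 2, and let T : V → V be an invertible linear map. Then V admits a T-invariant nondegenerate c-hermitian form if and only if T satisfies condition (ED): for every monic irreducible polynomial p over F with p ≠ x and every integer k ≥ 1, dim_F ker p(T)^k = dim_F ker p*(T)^k. (Condition (ED) is the statement that every elementary divisor of T is self-dual, or its dual is also an elementary divisor of T with the same multiplicity.) -/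
open Polynomial Module

/-- The dual polynomial `f*(x) = c(f(0))⁻¹ ⬝ x^(deg f) ⬝ f^c(1/x)` of a polynomial `f`
with `f(0) ≠ 0`, relative to an involution `c` of the base field. -/
noncomputable def dualPoly {F : Type*} [Field F] (c : F →+* F) (f : Polynomial F) :
    Polynomial F :=
  (c (f.coeff 0))⁻¹ • (f.map c).reverse

/-- `T`-invariant nondegenerate `c`-hermitian form exists. -/
def HasForm {F : Type*} [Field F] (c : F →+* F)
    {V : Type*} [AddCommGroup V] [Module F V] (T : V →ₗ[F] V) : Prop :=
  ∃ σ : V → V → F,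
      (∀ u v w : V, σ (u + v) w = σ u w + σ v w) ∧
      (∀ u v w : V, σ u (v + w) = σ u v + σ u w) ∧
      (∀ (a b : F) (v w : V), σ (a • v) (b • w) = a * c b * σ v w) ∧
      (∀ v w : V, σ v w = c (σ w v)) ∧
      (∀ v : V, (∀ w : V, σ v w = 0) → v = 0) ∧
      (∀ v w : V, σ (T v) (T w) = σ v w)

/-- Condition (ED). -/
def CondED {F : Type*} [Field F] (c : F →+* F)
    {V : Type*} [AddCommGroup V] [Module F V] (T : V →ₗ[F] V) : Prop :=
  ∀ p : Polynomial F, p.Monic → Irreducible p → p ≠ X → ∀ k : ℕ, 1 ≤ k →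
      finrank F (LinearMap.ker (aeval T p ^ k)) =
        finrank F (LinearMap.ker (aeval T (dualPoly c p) ^ k))

/-- Orthogonal subspaces have complementary-bounded dimensions. -/
lemma finrank_add_le_of_orthogonal {F : Type*} [Field F] (c : F →+* F) (hc : ∀ x, c (c x) = x)
    {V : Type*} [AddCommGroup V] [Module F V] [FiniteDimensional F V]
    (σ : V → V → F)
    (h1 : ∀ u v w : V, σ (u + v) w = σ u w + σ v w)
    (h2 : ∀ u v w : V, σ u (v + w) = σ u v + σ u w)
    (h3 : ∀ (a b : F) (v w : V), σ (a • v) (b • w) = a * c b * σ v w)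
    (h4 : ∀ v w : V, σ v w = c (σ w v))
    (h5 : ∀ v : V, (∀ w : V, σ v w = 0) → v = 0)
    (A B : Submodule F V) (h : ∀ a ∈ A, ∀ b ∈ B, σ a b = 0) :
    finrank F A + finrank F B ≤ finrank F V := by
  have h3l : ∀ (a : F) (v w : V), σ (a • v) w = a * σ v w := by
    intro a v w
    simpa using h3 a 1 v w
  have h3r : ∀ (a : F) (v w : V), σ v (a • w) = c a * σ v w := by
    intro a v w
    simpa using h3 1 a v w
  let fn : V → Module.Dual F V := fun b =>
    { toFun := fun a => σ a b
      map_add' := fun x y => h1 x y b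
      map_smul' := fun r x => by simpa using h3l r x b }
  have hfn : ∀ b ∈ B, fn b ∈ A.dualAnnihilator := by
    intro b hb
    rw [Submodule.mem_dualAnnihilator]
    intro a ha
    exact h a ha b hb
  let j : B →+ A.dualAnnihilator := AddMonoidHom.mk' (fun b => ⟨fn b, hfn b b.2⟩) (by
    intro x y
    ext a
    exact h2 a x y)
  have hj : Function.Injective j := by
    rw [injective_iff_map_eq_zero]
    intro b hb
    have hb' : fn b = 0 := congrArg Subtype.val hb
    have : (b : V) = 0 := by
      apply h5
      intro w
      rw [h4]
      have : σ w b = 0 := LinearMap.congr_fun hb' w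
      rw [this, map_zero]
    exact Subtype.ext this
  have hle := lift_rank_le_of_surjective_injective (R := F) (R' := F) (fun x => c x) j
    (fun x => ⟨c x, hc x⟩) hj (by
      intro r m
      ext a
      exact h3r r a m)
  have hle' : finrank F B ≤ finrank F A.dualAnnihilator := by
    rw [← finrank_eq_rank, ← finrank_eq_rank, Cardinal.lift_natCast, Cardinal.lift_natCast] at hle
    exact_mod_cast hle
  have := Subspace.finrank_add_finrank_dualAnnihilator_eq A
  omega

lemma form_reflect {F : Type*} [Field F] (c : F →+* F) 
    {V : Type*} [AddCommGroup V] [Module F V] 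
    (T : V →ₗ[F] V) (σ : V → V → F)
    (h1 : ∀ u v w : V, σ (u + v) w = σ u w + σ v w)
    (h2 : ∀ u v w : V, σ u (v + w) = σ u v + σ u w)
    (hc : ∀ x, c (c x) = x)
    (h3 : ∀ (a b : F) (v w : V), σ (a • v) (b • w) = a * c b * σ v w)
    (h6 : ∀ v w : V, σ (T v) (T w) = σ v w) (N : ℕ) (f : F[X]) (hf : f.natDegree ≤ N) :
    ∀ v w, σ (aeval T f v) ((T ^ N) w) = σ v (aeval T (reflect N (f.map c)) w) := by
  have h3l : ∀ (a : F) (v w : V), σ (a • v) w = a * σ v w := by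
    intro a v w
    simpa using h3 a 1 v w
  have h3r : ∀ (a : F) (v w : V), σ v (a • w) = c a * σ v w := by
    intro a v w
    simpa using h3 1 a v w
  have h6' : ∀ (n : ℕ) (v w : V), σ ((T ^ n) v) ((T ^ n) w) = σ v w := by
    intro n
    induction n with
    | zero => simp
    | succ n ih => 
      intro v w
      rw [pow_succ, Module.End.mul_apply, Module.End.mul_apply, ih, h6]
  have hz1 : ∀ w, σ 0 w = 0 := fun w => by simpa using h3l 0 0 w
  have hz2 : ∀ w, σ w 0 = 0 := fun w => by simpa using h3r 0 w 0
  refine induction_with_natDegree_le (fun f => ∀ v w, σ (aeval T f v) ((T ^ N) w) =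
    σ v (aeval T (reflect N (f.map c)) w)) N ?_ ?_ ?_ f hf
  · simp [hz1, hz2]
  · intro n r _ hn v w
    have : reflect N ((C r * X ^ n).map c) = C (c r) * X ^ (N - n) := by
      rw [Polynomial.map_mul, map_C, Polynomial.map_pow, map_X, reflect_C_mul_X_pow, revAt_le hn]
    rw [this]
    simp only [map_mul, aeval_C, map_pow, aeval_X, Module.End.mul_apply,
      Module.algebraMap_end_apply]
    rw [h3l, h3r, hc, ← h6' n v, ← Module.End.mul_apply (T ^ n) (T ^ (N - n)), ← pow_add]
    congr 4
    omega
  · intro f g _ _ hf hg v w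
    rw [Polynomial.map_add, reflect_add, map_add, map_add, LinearMap.add_apply,
      LinearMap.add_apply, h1, h2, hf, hg]

lemma HasForm.condED {F : Type*} [Field F] (c : F →+* F) (hc : ∀ x, c (c x) = x)
    {V : Type*} [AddCommGroup V] [Module F V] [FiniteDimensional F V]
    (T : V →ₗ[F] V) (hT : Function.Bijective T) (h : HasForm c T) : CondED c T := by
  obtain ⟨σ, h1, h2, h3, h4, h5, h6⟩ := h
  intro p hp hirr hX k hk
  have hp0 : p.coeff 0 ≠ 0 := by
    intro h0
    have : X ∣ p := X_dvd_iff.mpr h0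
    exact hX ((eq_of_monic_of_associated monic_X hp
      (irreducible_X.associated_of_dvd hirr this)).symm)
  set A := aeval T p
  set B := aeval T (p.map c).reverse with hB
  set d := p.natDegree with hd
  have hAB : ∀ v w, σ (A v) ((T ^ d) w) = σ v (B w) := by
    intro v w
    have := form_reflect c T σ h1 h2 hc h3 h6 d p le_rfl v w
    rw [this, hB, reverse, natDegree_map]
  have hcomm : Commute (T ^ d) B := by
    have : T ^ d = aeval T (X ^ d : F[X]) := by simp
    rw [this, hB]
    exact (Commute.all _ _).map (aeval T)
  have hABk : ∀ k v w, σ ((A ^ k) v) (((T ^ d) ^ k) w) = σ v ((B ^ k) w) := by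
    intro k
    induction k with
    | zero => simp
    | succ k ih =>
      intro v w
      rw [pow_succ, Module.End.mul_apply, pow_succ, Module.End.mul_apply, ih,
        ← Module.End.mul_apply, ← (hcomm.pow_right k).eq, Module.End.mul_apply, hAB, pow_succ',
        Module.End.mul_apply]
  have hker : LinearMap.ker (aeval T (dualPoly c p) ^ k) = LinearMap.ker (B ^ k) := by
    rw [dualPoly, map_smul, _root_.smul_pow, LinearMap.ker_smul]
    exact pow_ne_zero _ (inv_ne_zero (by simpa using hp0))
  rw [hker]
  have hTk : Function.Injective ((T ^ d) ^ k) := by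
    rw [← pow_mul, Module.End.coe_pow]
    exact hT.1.iterate _
  have e1 := finrank_add_le_of_orthogonal c hc σ h1 h2 h3 h4 h5 (LinearMap.ker (A ^ k))
    (LinearMap.range (B ^ k)) (by
      rintro a ha _ ⟨w, rfl⟩
      rw [← hABk, LinearMap.mem_ker.mp ha]
      simpa using h3 0 1 0 (((T ^ d) ^ k) w))
  have e2 := finrank_add_le_of_orthogonal c hc σ h1 h2 h3 h4 h5 (LinearMap.range (A ^ k))
    ((LinearMap.ker (B ^ k)).map ((T ^ d) ^ k)) (by
      rintro _ ⟨v, rfl⟩ _ ⟨w, hw, rfl⟩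
      rw [hABk, LinearMap.mem_ker.mp hw]
      simpa using h3 1 0 v 0)
  rw [← (Submodule.equivMapOfInjective _ hTk _).finrank_eq] at e2
  have e3 := LinearMap.finrank_range_add_finrank_ker (A ^ k)
  have e4 := LinearMap.finrank_range_add_finrank_ker (B ^ k)
  omega

lemma HasForm.of_prod {F : Type*} [Field F] (c : F →+* F)
    {V V₁ V₂ : Type*} [AddCommGroup V] [Module F V] [AddCommGroup V₁] [Module F V₁]
    [AddCommGroup V₂] [Module F V₂] (T : V →ₗ[F] V) (T₁ : V₁ →ₗ[F] V₁) (T₂ : V₂ →ₗ[F] V₂)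
    (e : V ≃ₗ[F] V₁ × V₂) (he : ∀ v, e (T v) = (T₁ (e v).1, T₂ (e v).2))
    (H₁ : HasForm c T₁) (H₂ : HasForm c T₂) : HasForm c T := by
  obtain ⟨σ, h1, h2, h3, h4, h5, h6⟩ := H₁
  obtain ⟨τ, k1, k2, k3, k4, k5, k6⟩ := H₂
  refine ⟨fun v w => σ (e v).1 (e w).1 + τ (e v).2 (e w).2, ?_, ?_, ?_, ?_, ?_, ?_⟩
  · intro u v w
    simp only [map_add, Prod.fst_add, Prod.snd_add, h1, k1]; ring
  · intro u v w
    simp only [map_add, Prod.fst_add, Prod.snd_add, h2, k2]; ring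
  · intro a b v w
    simp only [map_smul, Prod.smul_fst, Prod.smul_snd, h3, k3]; ring
  · intro v w
    rw [map_add, ← h4, ← k4]
  · intro v hv
    have z2 : ∀ x, τ x 0 = 0 := fun x => by simpa using k3 1 0 x 0
    have z1 : ∀ x, σ x 0 = 0 := fun x => by simpa using h3 1 0 x 0
    have a1 : (e v).1 = 0 := by
      apply h5
      intro w
      simpa [z2] using hv (e.symm (w, 0))
    have a2 : (e v).2 = 0 := by
      apply k5
      intro w
      simpa [z1] using hv (e.symm (0, w))
    apply e.injective
    rw [map_zero]
    exact Prod.ext a1 a2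
  · intro v w
    simp only [he, h6, k6]

lemma finrank_ker_prod {F : Type*} [Field F]
    {V V₁ V₂ : Type*} [AddCommGroup V] [Module F V] [AddCommGroup V₁] [Module F V₁]
    [AddCommGroup V₂] [Module F V₂] [FiniteDimensional F V₁] [FiniteDimensional F V₂]
    (T : V →ₗ[F] V) (T₁ : V₁ →ₗ[F] V₁) (T₂ : V₂ →ₗ[F] V₂)
    (e : V ≃ₗ[F] V₁ × V₂) (he : ∀ v, e (T v) = (T₁ (e v).1, T₂ (e v).2)) (g : F[X]) :
    finrank F (LinearMap.ker (aeval T g)) = finrank F (LinearMap.ker (aeval T₁ g)) +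
      finrank F (LinearMap.ker (aeval T₂ g)) := by
  have key : ∀ v, e (aeval T g v) = (aeval T₁ g (e v).1, aeval T₂ g (e v).2) := by
    induction g using Polynomial.induction_on' with
    | add p q hp hq => intro v; simp [hp, hq]
    | monomial n a =>
      intro v
      have : ∀ n v, e ((T ^ n) v) = ((T₁ ^ n) (e v).1, (T₂ ^ n) (e v).2) := by
        intro n
        induction n with
        | zero => simp
        | succ n ih => intro v; simp only [pow_succ, Module.End.mul_apply, ih, he]
      simp [aeval_monomial, this, Module.algebraMap_end_apply]
  rw [← Module.finrank_prod]
  apply LinearEquiv.finrank_eq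
  refine LinearEquiv.ofBijective
    (LinearMap.prod
      (((LinearMap.fst F V₁ V₂ ∘ₗ e.toLinearMap) ∘ₗ (LinearMap.ker (aeval T g)).subtype).codRestrict
        (LinearMap.ker (aeval T₁ g)) ?_)
      (((LinearMap.snd F V₁ V₂ ∘ₗ e.toLinearMap) ∘ₗ (LinearMap.ker (aeval T g)).subtype).codRestrict
        (LinearMap.ker (aeval T₂ g)) ?_)) ⟨?_, ?_⟩
  · rintro ⟨v, hv⟩
    have := key v
    rw [LinearMap.mem_ker.mp hv, map_zero] at this
    exact (congrArg Prod.fst this).symm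
  · rintro ⟨v, hv⟩
    have := key v
    rw [LinearMap.mem_ker.mp hv, map_zero] at this
    exact (congrArg Prod.snd this).symm
  · rintro ⟨v, hv⟩ ⟨w, hw⟩ h
    have h1 := congrArg (fun x => (x.1 : V₁)) h
    have h2 := congrArg (fun x => (x.2 : V₂)) h
    apply Subtype.ext
    apply e.injective
    exact Prod.ext h1 h2
  · rintro ⟨⟨x, hx⟩, ⟨y, hy⟩⟩
    refine ⟨⟨e.symm (x, y), ?_⟩, ?_⟩
    · rw [LinearMap.mem_ker]
      apply e.injective
      rw [key, map_zero]
      simp [LinearMap.mem_ker.mp hx, LinearMap.mem_ker.mp hy]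
    · apply Prod.ext <;> apply Subtype.ext <;> simp

lemma CondED.of_prod {F : Type*} [Field F] (c : F →+* F)
    {V V₁ V₂ : Type*} [AddCommGroup V] [Module F V] [AddCommGroup V₁] [Module F V₁]
    [AddCommGroup V₂] [Module F V₂] [FiniteDimensional F V₁] [FiniteDimensional F V₂]
    (T : V →ₗ[F] V) (T₁ : V₁ →ₗ[F] V₁) (T₂ : V₂ →ₗ[F] V₂)
    (e : V ≃ₗ[F] V₁ × V₂) (he : ∀ v, e (T v) = (T₁ (e v).1, T₂ (e v).2))
    (H : CondED c T) (H₁ : CondED c T₁) : CondED c T₂ := by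
  intro p hp hirr hX k hk
  have a := H p hp hirr hX k hk
  have b := H₁ p hp hirr hX k hk
  rw [← _root_.map_pow, ← _root_.map_pow] at a b ⊢
  rw [finrank_ker_prod T T₁ T₂ e he, finrank_ker_prod T T₁ T₂ e he] at a
  omega

/-- Unnormalised dual polynomial. -/
noncomputable def revc {F : Type*} [Field F] (c : F →+* F) (f : F[X]) : F[X] :=
  (f.map c).reverse

section revc
variable {F : Type*} [Field F] (c : F →+* F)

lemma revc_mul (f g : F[X]) : revc c (f * g) = revc c f * revc c g := by
  rw [revc, Polynomial.map_mul, reverse_mul_of_domain]; rfl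

lemma revc_C (a : F) : revc c (C a) = C (c a) := by
  rw [revc, map_C, reverse_C]

lemma revc_pow (f : F[X]) (n : ℕ) : revc c (f ^ n) = revc c f ^ n := by
  induction n with
  | zero => simpa using revc_C c 1
  | succ n ih => rw [pow_succ, revc_mul, ih, pow_succ]

lemma natDegree_revc (f : F[X]) (hf : f.coeff 0 ≠ 0) : (revc c f).natDegree = f.natDegree := by
  rw [revc, reverse_natDegree, natDegree_map]
  have : (f.map c).natTrailingDegree = 0 := by
    rw [natTrailingDegree_eq_zero]
    right
    simpa using hf
  omega

lemma revc_revc (hc : ∀ x, c (c x) = x) (f : F[X]) (hf : f.coeff 0 ≠ 0) :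
    revc c (revc c f) = f := by
  have h := natDegree_revc c f hf
  rw [revc, reverse, natDegree_map, h, revc, reverse, natDegree_map, ← reflect_map, Polynomial.map_map,
    reflect_reflect]
  have : c.comp c = RingHom.id F := by ext x; simp [hc]
  rw [this, Polynomial.map_id]

lemma coeff_zero_revc (f : F[X]) : (revc c f).coeff 0 = c f.leadingCoeff := by
  rw [revc, coeff_zero_reverse, leadingCoeff_map]

lemma irreducible_revc (hc : ∀ x, c (c x) = x) (p : F[X]) (hp : p.coeff 0 ≠ 0)
    (hirr : Irreducible p) : Irreducible (revc c p) := by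
  have hrr := revc_revc c hc p hp
  have h0 : (revc c p).coeff 0 ≠ 0 := by
    rw [coeff_zero_revc]
    simpa using hirr.ne_zero
  have hu : ∀ a : F[X], a.coeff 0 ≠ 0 → IsUnit (revc c a) → IsUnit a := by
    intro a ha h
    have h1 := natDegree_eq_zero_of_isUnit h
    rw [natDegree_revc c a ha] at h1
    rw [isUnit_iff_degree_eq_zero, degree_eq_natDegree (by rintro rfl; simp at ha), h1]
    rfl
  constructor
  · intro h
    apply hirr.not_isUnit
    have h1 := natDegree_eq_zero_of_isUnit h
    rw [natDegree_revc c p hp] at h1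
    rw [isUnit_iff_degree_eq_zero, degree_eq_natDegree hirr.ne_zero, h1]
    rfl
  · intro a b hab
    have hab0 : a.coeff 0 ≠ 0 ∧ b.coeff 0 ≠ 0 := by
      rw [hab, mul_coeff_zero] at h0
      exact ⟨left_ne_zero_of_mul h0, right_ne_zero_of_mul h0⟩
    have : p = revc c a * revc c b := by rw [← revc_mul, ← hab, hrr]
    rcases hirr.isUnit_or_isUnit this with h | h
    · exact Or.inl (hu a hab0.1 h)
    · exact Or.inr (hu b hab0.2 h)

end revc

lemma exists_hermitian_functional {F : Type*} [Field F] (c : F →+* F) (hc : ∀ x, c (c x) = x)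
    (hnt : ∃ x : F, c x ≠ x) {R : Type*} [CommRing R] [Algebra F R]
    (bar : R →+* R) (hbar : ∀ r, bar (bar r) = r)
    (hbc : ∀ a : F, bar (algebraMap F R a) = algebraMap F R (c a)) (s : R) (hs : s ≠ 0) :
    ∃ l : R →ₗ[F] F, (∀ r, l (bar r) = c (l r)) ∧ l s ≠ 0 := by
  obtain ⟨l0, hl0⟩ : ∃ l0 : Module.Dual F R, l0 s ≠ 0 := by
    by_contra! h
    exact hs ((Module.forall_dual_apply_eq_zero_iff F s).mp h)
  let lf : F → (R →ₗ[F] F) := fun a =>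
    { toFun := fun r => a * l0 r + c (a * l0 (bar r))
      map_add' := fun x y => by simp only [map_add, mul_add, map_mul]; ring
      map_smul' := fun b x => by
        rw [Algebra.smul_def b x, map_mul bar, hbc, ← Algebra.smul_def, ← Algebra.smul_def,
          map_smul, map_smul]
        simp only [smul_eq_mul, map_mul, hc, RingHom.id_apply]; ring }
  have hlf : ∀ a r, lf a r = a * l0 r + c (a * l0 (bar r)) := fun _ _ => rfl
  have hherm : ∀ a r, lf a (bar r) = c (lf a r) := by
    intro a r
    rw [hlf, hlf, hbar, map_add, hc, add_comm]
  by_contra! hcon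
  have hall : ∀ a, lf a s = 0 := fun a => hcon (lf a) (hherm a)
  obtain ⟨x, hx⟩ := hnt
  have e1 := hall 1
  have e2 := hall x
  rw [hlf, map_mul] at e1 e2
  rw [map_one] at e1
  have : (x - c x) * l0 s = 0 := by linear_combination e2 - c x * e1
  rcases mul_eq_zero.mp this with h | h
  · exact hx (sub_eq_zero.mp h).symm
  · exact hl0 h

lemma hasForm_of_bar {F : Type*} [Field F] (c : F →+* F) (hc : ∀ x, c (c x) = x)
    {R : Type*} [CommRing R] [Algebra F R]
    (bar : R →+* R) (hbar : ∀ r, bar (bar r) = r)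
    (hbc : ∀ a : F, bar (algebraMap F R a) = algebraMap F R (c a))
    (l : R →ₗ[F] F) (hl : ∀ r, l (bar r) = c (l r))
    (hnd : ∀ r, (∀ s, l (r * s) = 0) → r = 0) (x : R) (hx : x * bar x = 1) :
    HasForm c (LinearMap.mulLeft F x) := by
  refine ⟨fun r s => l (r * bar s), ?_, ?_, ?_, ?_, ?_, ?_⟩
  · intro u v w; beta_reduce; rw [add_mul, map_add]
  · intro u v w; beta_reduce; rw [map_add, mul_add, map_add]
  · intro a b v w
    beta_reduce
    rw [Algebra.smul_def b, map_mul bar, hbc, ← Algebra.smul_def, smul_mul_assoc, mul_smul_comm,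
      map_smul, map_smul, smul_eq_mul, smul_eq_mul]
    ring
  · intro v w
    rw [← hl, map_mul, hbar, mul_comm]
  · intro v hv
    apply hnd
    intro s
    simpa [hbar] using hv (bar s)
  · intro v w
    simp only [LinearMap.mulLeft_apply, map_mul]
    congr 1
    linear_combination (v * bar w) * hx

/-- The involution on `F[x]/(f)`. -/
lemma exists_bar {F : Type*} [Field F] (c : F →+* F) (hc : ∀ x, c (c x) = x)
    (f : F[X]) (hf0 : f.coeff 0 ≠ 0) (hf : f ∣ revc c f) :
    ∃ bar : AdjoinRoot f →+* AdjoinRoot f, (∀ r, bar (bar r) = r) ∧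
      (∀ a : F, bar (algebraMap F _ a) = algebraMap F _ (c a)) ∧
      AdjoinRoot.root f * bar (AdjoinRoot.root f) = 1 ∧
      ∀ g : F[X], bar (AdjoinRoot.mk f g) * AdjoinRoot.root f ^ g.natDegree =
        AdjoinRoot.mk f (revc c g) := by
  have hu : ∃ y, AdjoinRoot.root f * y = 1 := by
    have hcop : IsCoprime X f :=
      (irreducible_X.coprime_iff_not_dvd).mpr (by rwa [X_dvd_iff])
    obtain ⟨a, b, hab⟩ := hcop
    refine ⟨AdjoinRoot.mk f a, ?_⟩
    have := congrArg (AdjoinRoot.mk f) hab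
    simpa [mul_comm] using this
  obtain ⟨y, hy⟩ := hu
  have key : ∀ g : F[X], eval₂ ((AdjoinRoot.of f).comp c) y g * AdjoinRoot.root f ^ g.natDegree =
        AdjoinRoot.mk f (revc c g) := by
    intro g
    let _ : Invertible y := ⟨AdjoinRoot.root f, hy, by rw [mul_comm]; exact hy⟩
    have h := eval₂_reverse_mul_pow (AdjoinRoot.of f) y (g.map c)
    have h' : ⅟y = AdjoinRoot.root f := rfl
    rw [h', natDegree_map, eval₂_map] at h
    rw [← h, mul_assoc, ← mul_pow, mul_comm y, hy, one_pow, mul_one, revc, ← AdjoinRoot.aeval_eq]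
    rfl
  have hpow : ∀ n (z : AdjoinRoot f), z * AdjoinRoot.root f ^ n = 0 → z = 0 := by
    intro n z hz
    calc z = (z * AdjoinRoot.root f ^ n) * y ^ n := by
          rw [mul_assoc, ← mul_pow, hy, one_pow, mul_one]
      _ = 0 := by rw [hz, zero_mul]
  have h0 : eval₂ ((AdjoinRoot.of f).comp c) y f = 0 := by
    apply hpow f.natDegree
    rw [key, AdjoinRoot.mk_eq_zero]
    exact hf
  let bar := AdjoinRoot.lift ((AdjoinRoot.of f).comp c) y h0
  have hbr : bar (AdjoinRoot.root f) = y := AdjoinRoot.lift_root h0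
  have hbc : ∀ a : F, bar (algebraMap F _ a) = algebraMap F _ (c a) := by
    intro a
    exact AdjoinRoot.lift_of h0
  have hby : bar y = AdjoinRoot.root f := by
    have := congrArg bar hy
    rw [map_mul, hbr, map_one] at this
    linear_combination AdjoinRoot.root f * this - bar y * hy
  refine ⟨bar, ?_, hbc, ?_, ?_⟩
  · intro r
    have : bar.comp bar = RingHom.id _ := by
      apply AdjoinRoot.ringHom_ext
      · ext a
        have := hbc (c a)
        rw [← hbc a, hc] at this
        exact this
      · simp [hbr, hby]
    exact RingHom.congr_fun this r
  · rw [hbr, hy]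
  · intro g
    rw [← key, ← AdjoinRoot.lift_mk h0 g]

lemma dvd_socle {F : Type*} [Field F] (f p q s t : F[X]) 
    (hq : Irreducible q) (hp : Irreducible p)
    (hfac : ∀ π, Irreducible π → π ∣ f → Associated π p ∨ Associated π q)
    (hf0 : f ≠ 0)
    (hs : f = p * s) (ht : f ∣ q * t)
    (r : AdjoinRoot f) (hr : r ≠ 0) : r ∣ AdjoinRoot.mk f s ∨ r ∣ AdjoinRoot.mk f t := by
  obtain ⟨g, rfl⟩ := AdjoinRoot.mk_surjective r
  classical
  set d := EuclideanDomain.gcd g f with hd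
  have hdf : d ∣ f := EuclideanDomain.gcd_dvd_right _ _
  have hdg : d ∣ g := EuclideanDomain.gcd_dvd_left _ _
  have hgd : AdjoinRoot.mk f g ∣ AdjoinRoot.mk f d := by
    have := congrArg (AdjoinRoot.mk f) (EuclideanDomain.gcd_eq_gcd_ab g f)
    rw [map_add, map_mul, map_mul, AdjoinRoot.mk_self, zero_mul, add_zero] at this
    exact ⟨_, this⟩
  have hfg : ¬ f ∣ g := fun h => hr (AdjoinRoot.mk_eq_zero.mpr h)
  obtain ⟨e, he⟩ := hdf
  have hd0 : d ≠ 0 := by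
    intro h; rw [h, zero_mul] at he; exact hf0 he
  have he0 : e ≠ 0 := by
    intro h; rw [h, mul_zero] at he; exact hf0 he
  have heu : ¬ IsUnit e := by
    intro h
    apply hfg
    rw [he]
    exact (h.mul_right_dvd).mpr hdg
  obtain ⟨π, hπ, hπe⟩ := WfDvdMonoid.exists_irreducible_factor heu he0
  rcases hfac π hπ (hπe.trans ⟨d, by rw [he, mul_comm]⟩) with h | h
  · left
    apply hgd.trans
    apply _root_.map_dvd
    have h1 : p * d ∣ p * s := by
      rw [← hs, he, mul_comm d]
      exact mul_dvd_mul (h.symm.dvd.trans hπe) dvd_rfl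
    exact (mul_dvd_mul_iff_left hp.ne_zero).mp h1
  · right
    apply hgd.trans
    apply _root_.map_dvd
    have h1 : q * d ∣ q * t := by
      refine dvd_trans ?_ ht
      rw [he, mul_comm d]
      exact mul_dvd_mul (h.symm.dvd.trans hπe) dvd_rfl
    exact (mul_dvd_mul_iff_left hq.ne_zero).mp h1

lemma exists_split {F : Type*} [Field F]
    {V : Type*} [AddCommGroup V] [Module F V] [FiniteDimensional F V] (T : V →ₗ[F] V)
    (f : F[X]) (hf : f.Monic) (l : AdjoinRoot f →ₗ[F] F)
    (hnd : ∀ r, (∀ s, l (r * s) = 0) → r = 0)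
    (u : V) (hu : aeval T f u = 0) (hu' : ∀ g : F[X], aeval T g u = 0 → f ∣ g)
    (hI : ∀ w, aeval T f (aeval T f w) = 0 → aeval T f w = 0) :
    ∃ (W : Submodule F V) (hW : ∀ w ∈ W, T w ∈ W) (e : V ≃ₗ[F] AdjoinRoot f × W),
      ∀ v, e (T v) = (LinearMap.mulLeft F (AdjoinRoot.root f) (e v).1, T.restrict hW (e v).2) := by
  have : FiniteDimensional F (AdjoinRoot f) := (AdjoinRoot.powerBasis' hf).finite
  have hmul : ∀ (g h : F[X]) (v : V), aeval T (g * h) v = aeval T g (aeval T h v) := by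
    intro g h v
    rw [map_mul, Module.End.mul_apply]
  let sec : AdjoinRoot f →ₗ[F] F[X] := AdjoinRoot.modByMonicHom hf
  have hsec : ∀ g : F[X], sec (AdjoinRoot.mk f g) = g - (g /ₘ f) * f := by
    intro g
    rw [show sec (AdjoinRoot.mk f g) = g %ₘ f from AdjoinRoot.modByMonicHom_mk hf g,
      modByMonic_eq_sub_mul_div, mul_comm]
  let φ : AdjoinRoot f →ₗ[F] V :=
    (LinearMap.applyₗ u : (V →ₗ[F] V) →ₗ[F] V) ∘ₗ (aeval T).toLinearMap ∘ₗ sec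
  have hφ : ∀ g, φ (AdjoinRoot.mk f g) = aeval T g u := by
    intro g
    change aeval T (sec (AdjoinRoot.mk f g)) u = _
    rw [hsec, map_sub, LinearMap.sub_apply, hmul, hu, map_zero, sub_zero]
  have hφ0 : ∀ r, φ r = 0 → r = 0 := by
    intro r hr
    obtain ⟨g, rfl⟩ := AdjoinRoot.mk_surjective r
    rw [hφ] at hr
    exact AdjoinRoot.mk_eq_zero.mpr (hu' g hr)
  let I := LinearMap.range (aeval T f)
  have hinj : LinearMap.ker (I.mkQ ∘ₗ φ) = ⊥ := by
    rw [LinearMap.ker_eq_bot']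
    intro r hr
    rw [LinearMap.comp_apply, Submodule.mkQ_apply, Submodule.Quotient.mk_eq_zero] at hr
    obtain ⟨w, hw⟩ := hr
    apply hφ0
    rw [← hw]
    apply hI
    rw [hw]
    obtain ⟨g, rfl⟩ := AdjoinRoot.mk_surjective r
    rw [hφ, ← hmul, mul_comm, hmul, hu, map_zero]
  obtain ⟨π, hπ⟩ := LinearMap.exists_leftInverse_of_injective _ hinj
  let L : V →ₗ[F] F := l ∘ₗ π ∘ₗ I.mkQ
  have hLφ : ∀ r, L (φ r) = l r := by
    intro r
    exact congrArg l (LinearMap.congr_fun hπ r)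
  have hLf : ∀ w, L (aeval T f w) = 0 := by
    intro w
    have : I.mkQ (aeval T f w) = 0 := by
      rw [Submodule.mkQ_apply, Submodule.Quotient.mk_eq_zero]
      exact ⟨w, rfl⟩
    change l (π (I.mkQ (aeval T f w))) = 0
    rw [this, map_zero, map_zero]
  let Ψ : V →ₗ[F] (AdjoinRoot f →ₗ[F] F) := LinearMap.mk₂ F (fun w r => L (aeval T (sec r) w))
    (by intros; simp only [map_add]) (by intros; simp only [map_smul])
    (by intros; simp only [map_add, LinearMap.add_apply])
    (by intros; simp only [map_smul, LinearMap.smul_apply])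
  have hΨ : ∀ w g, Ψ w (AdjoinRoot.mk f g) = L (aeval T g w) := by
    intro w g
    change L (aeval T (sec (AdjoinRoot.mk f g)) w) = _
    rw [hsec, mul_comm, map_sub, LinearMap.sub_apply, hmul, map_sub, hLf, sub_zero]
  have hΨφ : ∀ r s, Ψ (φ r) s = l (r * s) := by
    intro r s
    obtain ⟨g, rfl⟩ := AdjoinRoot.mk_surjective r
    obtain ⟨h, rfl⟩ := AdjoinRoot.mk_surjective s
    rw [hΨ, hφ, ← hmul, ← hφ, hLφ, map_mul, mul_comm]
  have hEinj : Function.Injective (Ψ ∘ₗ φ) := by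
    rw [injective_iff_map_eq_zero]
    intro r hr
    apply hnd
    intro s
    rw [← hΨφ]
    exact LinearMap.congr_fun hr s
  have hEsurj : Function.Surjective (Ψ ∘ₗ φ) :=
    (LinearMap.injective_iff_surjective_of_finrank_eq_finrank
      (Subspace.dual_finrank_eq (K := F) (V := AdjoinRoot f)).symm).mp hEinj
  let E := LinearEquiv.ofBijective (Ψ ∘ₗ φ) ⟨hEinj, hEsurj⟩
  let D : V →ₗ[F] AdjoinRoot f := E.symm.toLinearMap ∘ₗ Ψ
  have hED : ∀ v, Ψ (φ (D v)) = Ψ v := fun v => E.apply_symm_apply (Ψ v)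
  have hDφ : ∀ r, D (φ r) = r := fun r => E.symm_apply_apply r
  have hDT : ∀ v, D (T v) = AdjoinRoot.root f * D v := by
    intro v
    apply hEinj
    change Ψ (φ (D (T v))) = Ψ (φ _)
    rw [hED]
    ext1 s
    rw [hΨφ, mul_comm (AdjoinRoot.root f), mul_assoc, ← hΨφ, hED]
    obtain ⟨h, rfl⟩ := AdjoinRoot.mk_surjective s
    rw [← AdjoinRoot.mk_X, ← map_mul, hΨ, hΨ, mul_comm, hmul, aeval_X]
  have hφT : ∀ r, φ (AdjoinRoot.root f * r) = T (φ r) := by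
    intro r
    obtain ⟨g, rfl⟩ := AdjoinRoot.mk_surjective r
    rw [← AdjoinRoot.mk_X, ← map_mul, hφ, hφ, hmul, aeval_X]
  have hW : ∀ w ∈ LinearMap.ker D, T w ∈ LinearMap.ker D := by
    intro w hw
    rw [LinearMap.mem_ker] at hw ⊢
    rw [hDT, hw, mul_zero]
  have hmem : ∀ v, (LinearMap.id - φ ∘ₗ D : V →ₗ[F] V) v ∈ LinearMap.ker D := by
    intro v
    simp [LinearMap.mem_ker, hDφ]
  let e0 : V →ₗ[F] AdjoinRoot f × LinearMap.ker D :=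
    D.prod ((LinearMap.id - φ ∘ₗ D : V →ₗ[F] V).codRestrict _ hmem)
  have he1 : ∀ v, (e0 v).1 = D v := fun _ => rfl
  have he2 : ∀ v, ((e0 v).2 : V) = v - φ (D v) := fun _ => rfl
  have hbij : Function.Bijective e0 := by
    constructor
    · rw [injective_iff_map_eq_zero]
      intro v hv
      have a1 : D v = 0 := by rw [← he1, hv]; rfl
      have a2 := he2 v
      rw [hv, a1, map_zero, sub_zero] at a2
      exact a2.symm
    · rintro ⟨r, w, hw⟩
      have hw' : D w = 0 := hw
      refine ⟨φ r + w, ?_⟩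
      have a1 : D (φ r + w) = r := by rw [map_add, hDφ, hw', add_zero]
      apply Prod.ext
      · rw [he1, a1]
      · apply Subtype.ext
        rw [he2, a1]
        simp
  refine ⟨LinearMap.ker D, hW, LinearEquiv.ofBijective e0 hbij, ?_⟩
  intro v
  rw [LinearEquiv.ofBijective_apply, LinearEquiv.ofBijective_apply]
  apply Prod.ext
  · exact hDT v
  · apply Subtype.ext
    rw [he2, hDT, hφT]
    change _ = T ((e0 v).2 : V)
    rw [he2, map_sub]

lemma pow_dvd_of_aeval {F : Type*} [Field F]
    {V : Type*} [AddCommGroup V] [Module F V] (T : V →ₗ[F] V)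
    (p : F[X]) (hp : Irreducible p) (m : ℕ) (v : V) (h1 : aeval T (p ^ (m + 1)) v = 0)
    (h2 : aeval T (p ^ m) v ≠ 0) (g : F[X]) (hg : aeval T g v = 0) : p ^ (m + 1) ∣ g := by
  classical
  have hd : aeval T (EuclideanDomain.gcd g (p ^ (m + 1))) v = 0 := by
    rw [EuclideanDomain.gcd_eq_gcd_ab, mul_comm g, mul_comm (p ^ (m + 1)), map_add, map_mul, map_mul, LinearMap.add_apply,
      Module.End.mul_apply, Module.End.mul_apply, h1, hg, map_zero, map_zero, add_zero]
  obtain ⟨i, hi, hass⟩ := (dvd_prime_pow hp.prime (m + 1)).mp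
    (EuclideanDomain.gcd_dvd_right g (p ^ (m + 1)))
  rcases Nat.lt_or_ge i (m + 1) with hlt | hge
  · exfalso
    apply h2
    obtain ⟨y, hy⟩ := hass.dvd.trans (pow_dvd_pow p (Nat.lt_succ_iff.mp hlt))
    rw [hy, mul_comm, map_mul, Module.End.mul_apply, hd, map_zero]
  · have : i = m + 1 := le_antisymm hi hge
    subst this
    exact hass.symm.dvd.trans (EuclideanDomain.gcd_dvd_left _ _)

lemma exists_common_index {F : Type*} [Field F]
    {V : Type*} [AddCommGroup V] [Module F V] [FiniteDimensional F V] (P Q : Module.End F V)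
    (hP : LinearMap.ker P ≠ ⊥)
    (h : ∀ k, 1 ≤ k → finrank F (LinearMap.ker (P ^ k)) = finrank F (LinearMap.ker (Q ^ k))) :
    ∃ m, (∃ v, (P ^ (m + 1)) v = 0 ∧ (P ^ m) v ≠ 0) ∧ (∃ v, (Q ^ (m + 1)) v = 0 ∧ (Q ^ m) v ≠ 0) ∧
      (∀ w, (P ^ (m + 1)) ((P ^ (m + 1)) w) = 0 → (P ^ (m + 1)) w = 0) ∧
      (∀ w, (Q ^ (m + 1)) ((Q ^ (m + 1)) w) = 0 → (Q ^ (m + 1)) w = 0) := by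
  classical
  have hle : ∀ (A : Module.End F V) k, LinearMap.ker (A ^ k) ≤ LinearMap.ker (A ^ (k + 1)) := by
    intro A k v hv
    rw [LinearMap.mem_ker] at hv ⊢
    rw [pow_succ', Module.End.mul_apply, hv, map_zero]
  have h' : ∀ k, finrank F (LinearMap.ker (P ^ k)) = finrank F (LinearMap.ker (Q ^ k)) := by
    intro k
    rcases Nat.eq_zero_or_pos k with rfl | hk
    · rw [pow_zero, pow_zero]
    · exact h k hk
  have hiff : ∀ k, LinearMap.ker (P ^ k) = LinearMap.ker (P ^ (k + 1)) ↔
      LinearMap.ker (Q ^ k) = LinearMap.ker (Q ^ (k + 1)) := by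
    intro k
    constructor
    · intro hk
      apply Submodule.eq_of_le_of_finrank_eq (hle Q k)
      rw [← h', ← h', hk]
    · intro hk
      apply Submodule.eq_of_le_of_finrank_eq (hle P k)
      rw [h', h', hk]
  have hex : ∃ k, LinearMap.ker (P ^ k) = LinearMap.ker (P ^ (k + 1)) := by
    obtain ⟨k, _, hk⟩ := Module.End.exists_ker_pow_eq_ker_pow_succ P
    exact ⟨k, hk⟩
  have hk := Nat.find_spec hex
  have hmin := fun m => Nat.find_min hex (m := m)
  generalize Nat.find hex = k at hk hmin
  obtain _ | m := k
  · exfalso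
    apply hP
    rw [zero_add, pow_zero, pow_one] at hk
    rw [← hk]
    exact LinearMap.ker_id
  · have hne := hmin m (Nat.lt_succ_self m)
    have hneQ := fun h => hne ((hiff m).mpr h)
    have hkQ := (hiff (m + 1)).mp hk
    have aux : ∀ A : Module.End F V, LinearMap.ker (A ^ m) ≠ LinearMap.ker (A ^ (m + 1)) →
        ∃ v, (A ^ (m + 1)) v = 0 ∧ (A ^ m) v ≠ 0 := by
      intro A hA
      by_contra! hcon
      exact hA (le_antisymm (hle A m) (fun v hv => hcon v hv))
    have aux2 : ∀ A : Module.End F V,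
        LinearMap.ker (A ^ (m + 1)) = LinearMap.ker (A ^ (m + 1 + 1)) →
        ∀ w, (A ^ (m + 1)) ((A ^ (m + 1)) w) = 0 → (A ^ (m + 1)) w = 0 := by
      intro A hA w hw
      have := Module.End.ker_pow_constant hA (m + 1)
      rw [← Module.End.mul_apply, ← pow_add] at hw
      have hw' : w ∈ LinearMap.ker (A ^ (m + 1 + (m + 1))) := hw
      rw [← this] at hw'
      exact hw'
    exact ⟨m, aux P hne, aux Q hneQ, aux2 P hk, aux2 Q hkQ⟩

lemma exists_irreducible_ker {F : Type*} [Field F]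
    {V : Type*} [AddCommGroup V] [Module F V] [FiniteDimensional F V] [Nontrivial V]
    (T : V →ₗ[F] V) :
    ∃ p : F[X], p.Monic ∧ Irreducible p ∧ LinearMap.ker (aeval T p) ≠ ⊥ := by
  classical
  have hint : IsIntegral F T := Algebra.IsIntegral.isIntegral T
  have hne := minpoly.ne_zero hint
  obtain ⟨p, hm, hp, hpd⟩ := exists_monic_irreducible_factor (minpoly F T)
    (minpoly.not_isUnit F T)
  refine ⟨p, hm, hp, ?_⟩
  intro hker
  obtain ⟨g, hg⟩ := hpd
  have hg0 : g ≠ 0 := by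
    rintro rfl
    rw [mul_zero] at hg
    exact hne hg
  have h0 : aeval T g = 0 := by
    ext v
    have h1 : aeval T p (aeval T g v) = 0 := by
      rw [← Module.End.mul_apply, ← map_mul, ← hg, minpoly.aeval, LinearMap.zero_apply]
    exact (LinearMap.ker_eq_bot'.mp hker) _ h1
  have h2 := minpoly.dvd F T h0
  rw [hg] at h2
  have h3 : p * g ∣ 1 * g := by rwa [one_mul]
  exact hp.not_isUnit (isUnit_of_dvd_one ((mul_dvd_mul_iff_right hg0).mp h3))

lemma exists_cyclic_data {F : Type*} [Field F] (c : F →+* F) (hc : ∀ x, c (c x) = x)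
    {V : Type*} [AddCommGroup V] [Module F V] [FiniteDimensional F V] [Nontrivial V]
    (T : V →ₗ[F] V) (hT : Function.Bijective T) (hED : CondED c T) :
    ∃ (p f s : F[X]) (u : V), Irreducible p ∧ Irreducible (revc c p) ∧
      f.Monic ∧ f.coeff 0 ≠ 0 ∧ f ∣ revc c f ∧ f = p * s ∧
      (∀ π, Irreducible π → π ∣ f → Associated π p ∨ Associated π (revc c p)) ∧
      aeval T f u = 0 ∧ (∀ g : F[X], aeval T g u = 0 → f ∣ g) ∧
      (∀ w, aeval T f (aeval T f w) = 0 → aeval T f w = 0) := by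
  obtain ⟨p, hm, hp, hker⟩ := exists_irreducible_ker T
  have hX : p ≠ X := by
    rintro rfl
    apply hker
    rw [aeval_X]
    exact LinearMap.ker_eq_bot.mpr hT.1
  have hp0 : p.coeff 0 ≠ 0 := by
    intro h0
    have : X ∣ p := X_dvd_iff.mpr h0
    exact hX ((eq_of_monic_of_associated monic_X hm
      (irreducible_X.associated_of_dvd hp this)).symm)
  have hmul : ∀ (g h : F[X]) (v : V), aeval T (g * h) v = aeval T g (aeval T h v) := by
    intro g h v
    rw [map_mul, Module.End.mul_apply]
  obtain ⟨m, ⟨v, hv1, hv2⟩, ⟨w, hw1, hw2⟩, hPI, hQI⟩ := exists_common_index (aeval T p)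
    (aeval T (dualPoly c p)) hker (fun k hk => hED p hm hp hX k hk)
  have hr := irreducible_revc c hc p hp0 hp
  set a := c (p.coeff 0) with ha
  have ha0 : a ≠ 0 := by simpa [ha] using hp0
  set q := dualPoly c p with hq
  have hqr : q = C a⁻¹ * revc c p := by
    rw [hq, dualPoly, smul_eq_C_mul]; rfl
  have hua : IsUnit (C a⁻¹ : F[X]) := isUnit_C.mpr (IsUnit.mk0 _ (inv_ne_zero ha0))
  have hass : Associated q (revc c p) := by
    rw [hqr]
    exact associated_unit_mul_left _ _ hua
  have hqirr : Irreducible q := hass.symm.irreducible hr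
  have hqm : q.Monic := by
    rw [hqr, Monic, leadingCoeff_mul, leadingCoeff_C, revc, reverse_leadingCoeff, trailingCoeff]
    have : (p.map c).natTrailingDegree = 0 := by
      rw [natTrailingDegree_eq_zero]
      right
      simpa using hp0
    rw [this, coeff_map]
    exact inv_mul_cancel₀ ha0
  have hq0 : q.coeff 0 ≠ 0 := by
    rw [hqr, mul_coeff_zero, coeff_C_zero, coeff_zero_revc, hm.leadingCoeff, map_one, mul_one]
    exact inv_ne_zero ha0
  have hpq : p ∣ revc c q := by
    rw [hqr, revc_mul, revc_revc c hc p hp0]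
    exact dvd_mul_left _ _
  rw [← map_pow] at hv1 hv2 hw1 hw2
  simp only [← _root_.map_pow] at hPI hQI
  by_cases hpqe : p = q
  · refine ⟨p, p ^ (m + 1), p ^ m, v, hp, hr, hm.pow _, ?_, ?_, pow_succ' _ _, ?_, hv1, ?_, hPI⟩
    · rw [coeff_zero_eq_eval_zero, eval_pow, ← coeff_zero_eq_eval_zero]
      exact pow_ne_zero _ hp0
    · rw [revc_pow]
      apply pow_dvd_pow_of_dvd
      conv_lhs => rw [hpqe]
      exact hass.dvd
    · intro π hπ hd
      left
      exact hπ.associated_of_dvd hp (hπ.prime.dvd_of_dvd_pow hd)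
    · intro g hg
      exact pow_dvd_of_aeval T p hp m v hv1 hv2 g hg
  · have hcop : IsCoprime p q := by
      rw [hp.coprime_iff_not_dvd]
      intro h
      exact hpqe (eq_of_monic_of_associated hm hqm (hp.associated_of_dvd hqirr h))
    have hcopk : IsCoprime (p ^ (m + 1)) (q ^ (m + 1)) := hcop.pow
    refine ⟨p, p ^ (m + 1) * q ^ (m + 1), p ^ m * q ^ (m + 1), v + w, hp, hr,
      (hm.pow _).mul (hqm.pow _), ?_, ?_, by ring, ?_, ?_, ?_, ?_⟩
    · rw [coeff_zero_eq_eval_zero, eval_mul, eval_pow, eval_pow, ← coeff_zero_eq_eval_zero,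
        ← coeff_zero_eq_eval_zero]
      exact mul_ne_zero (pow_ne_zero _ hp0) (pow_ne_zero _ hq0)
    · rw [revc_mul, revc_pow, revc_pow, mul_comm]
      exact mul_dvd_mul (pow_dvd_pow_of_dvd hass.dvd _) (pow_dvd_pow_of_dvd hpq _)
    · intro π hπ hd
      rcases hπ.prime.dvd_or_dvd hd with h | h
      · left
        exact hπ.associated_of_dvd hp (hπ.prime.dvd_of_dvd_pow h)
      · right
        exact (hπ.associated_of_dvd hqirr (hπ.prime.dvd_of_dvd_pow h)).trans hass
    · rw [map_add, hmul _ _ w, hw1, mul_comm, hmul, hv1]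
      simp
    · intro g hg
      apply hcopk.mul_dvd
      · apply hcopk.dvd_of_dvd_mul_left
        apply pow_dvd_of_aeval T p hp m v hv1 hv2
        have := congrArg (aeval T (q ^ (m + 1))) hg
        rw [map_add, map_add, ← hmul, ← hmul, mul_comm, hmul g _ w, hw1, map_zero, map_zero,
          add_zero, mul_comm] at this
        exact this
      · apply hcopk.symm.dvd_of_dvd_mul_left
        apply pow_dvd_of_aeval T q hqirr m w hw1 hw2
        have := congrArg (aeval T (p ^ (m + 1))) hg
        rw [map_add, map_add, ← hmul, ← hmul, mul_comm, hmul g _ v, hv1, map_zero, map_zero,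
          zero_add, mul_comm] at this
        exact this
    · intro z hz
      have h1 : aeval T (p ^ (m + 1)) (aeval T (p ^ (m + 1))
          (aeval T (q ^ (m + 1) * q ^ (m + 1)) z)) = 0 := by
        rw [← hmul, ← hmul, ← hz, ← hmul]
        congr 2
        ring
      have h2 := hPI _ h1
      have h3 : aeval T (q ^ (m + 1)) (aeval T (q ^ (m + 1)) (aeval T (p ^ (m + 1)) z)) = 0 := by
        rw [← h2, ← hmul, ← hmul, ← hmul]
        congr 2
        ring
      rw [mul_comm, hmul]
      exact hQI _ h3

lemma exists_form_on_cyclic {F : Type*} [Field F] (c : F →+* F) (hc : ∀ x, c (c x) = x)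
    (hnt : ∃ x : F, c x ≠ x) (p f s : F[X]) (hp : Irreducible p) (hq : Irreducible (revc c p))
    (hf : f.Monic) (hf0 : f.coeff 0 ≠ 0) (hfr : f ∣ revc c f) (hs : f = p * s)
    (hfac : ∀ π, Irreducible π → π ∣ f → Associated π p ∨ Associated π (revc c p)) :
    ∃ l : AdjoinRoot f →ₗ[F] F, (∀ r, (∀ s, l (r * s) = 0) → r = 0) ∧
      HasForm c (LinearMap.mulLeft F (AdjoinRoot.root f)) ∧
      Function.Bijective (LinearMap.mulLeft F (AdjoinRoot.root f)) := by
  obtain ⟨bar, hbar, hbc, hroot, hbmk⟩ := exists_bar c hc f hf0 hfr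
  have hs0 : s ≠ 0 := by
    rintro rfl
    rw [mul_zero] at hs
    exact hf.ne_zero hs
  have hms : AdjoinRoot.mk f s ≠ 0 := by
    intro h
    rw [AdjoinRoot.mk_eq_zero, hs] at h
    have h3 : p * s ∣ 1 * s := by rwa [one_mul]
    exact hp.not_isUnit (isUnit_of_dvd_one ((mul_dvd_mul_iff_right hs0).mp h3))
  obtain ⟨l, hl, hls⟩ := exists_hermitian_functional c hc hnt bar hbar hbc _ hms
  have hnd : ∀ r, (∀ s, l (r * s) = 0) → r = 0 := by
    intro r hr
    by_contra hr0
    rcases dvd_socle f p (revc c p) s (revc c s) hq hp hfac hf.ne_zero hs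
      (by rw [← revc_mul, ← hs]; exact hfr) r hr0 with ⟨y, hy⟩ | ⟨y, hy⟩
    · apply hls
      rw [hy, hr]
    · apply hls
      have h1 : bar (AdjoinRoot.mk f s) = r * (y * bar (AdjoinRoot.root f) ^ s.natDegree) := by
        rw [← mul_assoc, ← hy, ← hbmk, mul_assoc, ← mul_pow, hroot, one_pow, mul_one]
      have h2 := hl (AdjoinRoot.mk f s)
      rw [h1, hr] at h2
      rw [← hc (l _), ← h2, map_zero]
  refine ⟨l, hnd, hasForm_of_bar c hc bar hbar hbc l hl hnd _ hroot, ?_, ?_⟩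
  · intro x y hxy
    simp only [LinearMap.mulLeft_apply] at hxy
    have := congrArg (fun z => bar (AdjoinRoot.root f) * z) hxy
    simp only [← mul_assoc] at this
    rw [mul_comm (bar _), hroot, one_mul, one_mul] at this
    exact this
  · intro x
    refine ⟨bar (AdjoinRoot.root f) * x, ?_⟩
    rw [LinearMap.mulLeft_apply, ← mul_assoc, hroot, one_mul]

lemma CondED.hasForm {F : Type*} [Field F] (c : F →+* F) (hc : ∀ x, c (c x) = x)
    (hnt : ∃ x : F, c x ≠ x) (n : ℕ) :
    ∀ {V : Type*} [AddCommGroup V] [Module F V] [FiniteDimensional F V]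
    (T : V →ₗ[F] V) (_ : Function.Bijective T) (_ : finrank F V = n),
    CondED c T → HasForm c T := by
  induction n using Nat.strong_induction_on with
  | _ n ih =>
    intro V _ _ _ T hT hn hED
    rcases subsingleton_or_nontrivial V with hV | hV
    · refine ⟨fun _ _ => 0, by simp, by simp, by simp, by simp, ?_, by simp⟩
      intro v _
      exact Subsingleton.elim _ _
    · obtain ⟨p, f, s, u, hp, hq, hf, hf0, hfr, hs, hfac, hu, hu', hI⟩ :=
        exists_cyclic_data c hc T hT hED
      obtain ⟨l, hnd, hform, hbij⟩ :=
        exists_form_on_cyclic c hc hnt p f s hp hq hf hf0 hfr hs hfac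
      obtain ⟨W, hW, e, he⟩ := exists_split T f hf l hnd u hu hu' hI
      have : FiniteDimensional F (AdjoinRoot f) := (AdjoinRoot.powerBasis' hf).finite
      have hEDR := hform.condED c hc _ hbij
      have hEDW := CondED.of_prod c T _ _ e he hED hEDR
      have hWinj : Function.Injective (T.restrict hW) := by
        intro x y hxy
        apply Subtype.ext
        apply hT.1
        exact congrArg Subtype.val hxy
      have hWbij : Function.Bijective (T.restrict hW) :=
        ⟨hWinj, LinearMap.injective_iff_surjective.mp hWinj⟩
      have hdim : finrank F W < n := by
        rw [← hn, e.finrank_eq, Module.finrank_prod]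
        have hpos : 0 < finrank F (AdjoinRoot f) := by
          rw [(AdjoinRoot.powerBasis' hf).finrank, AdjoinRoot.powerBasis'_dim]
          have h1 : p.natDegree ≤ f.natDegree :=
            natDegree_le_of_dvd ⟨s, hs⟩ hf.ne_zero
          have := hp.natDegree_pos
          omega
        omega
      exact HasForm.of_prod c T _ _ e he hform (ih _ hdim (T.restrict hW) hWbij rfl hEDW)

/-- Let `F` be a field with a nontrivial involution `c`, `V` an `F`-vector space
of finite dimension `n ≥ 2`, and `T : V → V` an invertible linear map. Then `V` admits a
`T`-invariant nondegenerate `c`-hermitian form iff for every monic irreducible `p ≠ x` and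
every `k ≥ 1`, `dim ker p(T)^k = dim ker p*(T)^k`. -/
theorem invariant_hermitian_form_iff_self_dual_elementary_divisors
    {F : Type*} [Field F] (c : F →+* F) (hc : ∀ x, c (c x) = x)
    (hnt : ∃ x : F, c x ≠ x)
    {V : Type*} [AddCommGroup V] [Module F V] [FiniteDimensional F V]
    (hdim : 2 ≤ finrank F V)
    (T : V →ₗ[F] V) (hT : Function.Bijective T) :
    (∃ σ : V → V → F,
      (∀ u v w : V, σ (u + v) w = σ u w + σ v w) ∧
      (∀ u v w : V, σ u (v + w) = σ u v + σ u w) ∧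
      (∀ (a b : F) (v w : V), σ (a • v) (b • w) = a * c b * σ v w) ∧
      (∀ v w : V, σ v w = c (σ w v)) ∧
      (∀ v : V, (∀ w : V, σ v w = 0) → v = 0) ∧
      (∀ v w : V, σ (T v) (T w) = σ v w)) ↔
    (∀ p : Polynomial F, p.Monic → Irreducible p → p ≠ X → ∀ k : ℕ, 1 ≤ k →
      finrank F (LinearMap.ker (aeval T p ^ k)) =
        finrank F (LinearMap.ker (aeval T (dualPoly c p) ^ k))) := by
  constructor
  · intro h
    exact HasForm.condED c hc T hT h
  · intro h
    exact CondED.hasForm c hc hnt _ T hT rfl h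
end

section
/- Let F be a field with an involution c and let T ∈ GL_n(F), n ≥ 2. Then T is c-real (conjugate in GL_n(F) to (T^c)^{-1}) if and only if condition (ED) holds: for every monic irreducible polynomial p over F with p ≠ x and every integer k ≥ 1, dim_F ker p(T)^k = dim_F ker p*(T)^k. (Condition (ED) is the statement that every elementary divisor of T is self-dual, or its dual is also an elementary divisor of T with the same multiplicity.) -/
open Matrix Polynomial Module

universe u

lemma fk_pi {F : Type*} [Field F] {ι : Type*} [Fintype ι] (M : ι → Type*)
    [∀ i, AddCommGroup (M i)] [∀ i, Module F (M i)] [∀ i, Module F[X] (M i)]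
    [∀ i, IsScalarTower F F[X] (M i)] [∀ i, Module.Finite F (M i)] (g : F[X]) :
    finrank F (Submodule.torsionBy F[X] (∀ i, M i) g) =
      ∑ i, finrank F (Submodule.torsionBy F[X] (M i) g) := by
  have hfin : ∀ i, Module.Finite F (Submodule.torsionBy F[X] (M i) g) := fun i =>
    inferInstanceAs (Module.Finite F ((Submodule.torsionBy F[X] (M i) g).restrictScalars F))
  rw [← finrank_pi_fintype]
  refine LinearEquiv.finrank_eq
    { toFun := fun x i => ⟨x.1 i, ?_⟩
      invFun := fun x => ⟨fun i => (x i).1, ?_⟩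
      map_add' := fun x y => rfl
      map_smul' := fun a x => rfl
      left_inv := fun x => rfl
      right_inv := fun x => rfl }
  · have := x.2
    rw [Submodule.mem_torsionBy_iff] at this ⊢
    exact congrFun this i
  · rw [Submodule.mem_torsionBy_iff]
    funext i
    have := (x i).2
    rwa [Submodule.mem_torsionBy_iff] at this

lemma fk_congr {F : Type*} [Field F] {M N : Type*}
    [AddCommGroup M] [Module F M] [Module F[X] M] [IsScalarTower F F[X] M]
    [AddCommGroup N] [Module F N] [Module F[X] N] [IsScalarTower F F[X] N]
    (e : M ≃ₗ[F[X]] N) (g : F[X]) :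
    finrank F (Submodule.torsionBy F[X] M g) = finrank F (Submodule.torsionBy F[X] N g) := by
  refine LinearEquiv.finrank_eq
    { toFun := fun x => ⟨e x.1, ?_⟩
      invFun := fun x => ⟨e.symm x.1, ?_⟩
      map_add' := fun x y => by ext; simp
      map_smul' := fun a x => by
        ext
        exact (e.restrictScalars F).map_smul a x.1
      left_inv := fun x => by ext; simp
      right_inv := fun x => by ext; simp }
  all_goals
    have := x.2
    rw [Submodule.mem_torsionBy_iff] at this ⊢
    rw [← map_smul, this, map_zero]

lemma fk_quot_mul {F : Type*} [Field F] (a b : F[X]) (ha : a ≠ 0) (hb : b ≠ 0) :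
    finrank F (Submodule.torsionBy F[X] (F[X] ⧸ (Submodule.span F[X] {a * b})) a) = a.natDegree := by
  rw [← finrank_quotient_span_eq_natDegree (f := a)]
  symm
  let φ : (F[X] ⧸ Ideal.span {a}) →ₗ[F[X]] (F[X] ⧸ (Submodule.span F[X] {a * b})) :=
    Submodule.mapQ _ _ (LinearMap.mulLeft F[X] b) (by
      intro x hx
      rw [Ideal.mem_span_singleton] at hx
      obtain ⟨y, rfl⟩ := hx
      change b * (a * y) ∈ Ideal.span {a * b}
      rw [Ideal.mem_span_singleton]
      exact ⟨y, by ring⟩)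
  have hinj : Function.Injective φ := by
    rw [injective_iff_map_eq_zero]
    intro x
    obtain ⟨x, rfl⟩ := Submodule.Quotient.mk_surjective _ x
    intro h
    change Submodule.Quotient.mk (b * x) = 0 at h
    rw [Submodule.Quotient.mk_eq_zero] at h ⊢
    change _ ∈ Ideal.span _ at h
    rw [Ideal.mem_span_singleton] at h ⊢
    rw [mul_comm a b] at h
    exact (mul_dvd_mul_iff_left hb).1 h
  have hr : LinearMap.range φ = Submodule.torsionBy F[X] (F[X] ⧸ (Submodule.span F[X] {a * b})) a := by
    ext y
    rw [Submodule.mem_torsionBy_iff]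
    constructor
    · rintro ⟨x, rfl⟩
      obtain ⟨x, rfl⟩ := Submodule.Quotient.mk_surjective _ x
      change Submodule.Quotient.mk (a * (b * x)) = 0
      rw [Submodule.Quotient.mk_eq_zero]
      change _ ∈ Ideal.span _
      rw [Ideal.mem_span_singleton]
      exact ⟨x, by ring⟩
    · obtain ⟨y, rfl⟩ := Submodule.Quotient.mk_surjective _ y
      intro h
      change Submodule.Quotient.mk (a * y) = 0 at h
      rw [Submodule.Quotient.mk_eq_zero] at h
      change _ ∈ Ideal.span _ at h
      rw [Ideal.mem_span_singleton] at h
      obtain ⟨z, rfl⟩ := (mul_dvd_mul_iff_left ha).1 h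
      exact ⟨Submodule.Quotient.mk z, rfl⟩
  rw [← hr]
  exact ((LinearEquiv.ofInjective φ hinj).restrictScalars F).finrank_eq

lemma fk_quot_coprime {F : Type*} [Field F] (a b : F[X]) (h : IsCoprime a b) :
    finrank F (Submodule.torsionBy F[X] (F[X] ⧸ (Submodule.span F[X] {b})) a) = 0 := by
  have : Submodule.torsionBy F[X] (F[X] ⧸ (Submodule.span F[X] {b})) a = ⊥ := by
    rw [eq_bot_iff]
    intro y
    obtain ⟨y, rfl⟩ := Submodule.Quotient.mk_surjective _ y
    rw [Submodule.mem_torsionBy_iff]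
    intro h'
    change Submodule.Quotient.mk (a * y) = 0 at h'
    rw [Submodule.Quotient.mk_eq_zero] at h'
    change _ ∈ Ideal.span _ at h'
    rw [Submodule.mem_bot, Submodule.Quotient.mk_eq_zero]
    change _ ∈ Ideal.span _
    rw [Ideal.mem_span_singleton] at h' ⊢
    exact h.symm.dvd_of_dvd_mul_left h'
  rw [this]
  have : Subsingleton (⊥ : Submodule F[X] (F[X] ⧸ (Submodule.span F[X] {b}))) := inferInstance
  exact finrank_zero_of_subsingleton

lemma fk_quot {F : Type*} [Field F] [DecidableEq F[X]] (p q : F[X]) (hp : p.Monic) (hq : q.Monic)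
    (ip : Irreducible p) (iq : Irreducible q) (k e : ℕ) :
    finrank F (Submodule.torsionBy F[X] (F[X] ⧸ (Submodule.span F[X] {q ^ e})) (p ^ k)) =
      if q = p then min k e * p.natDegree else 0 := by
  split_ifs with h
  · subst h
    rcases le_total k e with h | h
    · obtain ⟨m, rfl⟩ := Nat.exists_eq_add_of_le h
      rw [pow_add, fk_quot_mul _ _ (pow_ne_zero _ hq.ne_zero) (pow_ne_zero _ hq.ne_zero),
        natDegree_pow, min_eq_left h]
    · have := fk_quot_mul (q ^ e) 1 (pow_ne_zero _ hq.ne_zero) one_ne_zero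
      rw [mul_one, natDegree_pow] at this
      rw [min_eq_right h, ← this]
      have : ∀ m, e ≤ m → Submodule.torsionBy F[X] (F[X] ⧸ (Submodule.span F[X] {q ^ e})) (q ^ m) = ⊤ := by
        intro m hm
        rw [eq_top_iff]
        intro y _
        obtain ⟨y, rfl⟩ := Submodule.Quotient.mk_surjective _ y
        rw [Submodule.mem_torsionBy_iff]
        change Submodule.Quotient.mk (q ^ m * y) = 0
        rw [Submodule.Quotient.mk_eq_zero]
        change _ ∈ Ideal.span _
        rw [Ideal.mem_span_singleton]
        exact (pow_dvd_pow q hm).trans (dvd_mul_right _ _)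
      rw [this k h, this e le_rfl]
  · apply fk_quot_coprime
    apply IsCoprime.pow
    rw [ip.coprime_iff_not_dvd]
    intro hd
    exact h (eq_of_monic_of_associated hq hp (ip.associated_of_dvd iq hd).symm)

/-- Decomposition with monic irreducibles and positive exponents. -/
lemma fk_decomp {F : Type u} [Field F] (M : Type*) [AddCommGroup M] [Module F[X] M]
    [Module.Finite F[X] M] (hM : Module.IsTorsion F[X] M) :
    ∃ (ι : Type u) (_ : Fintype ι) (p : ι → F[X]) (e : ι → ℕ), (∀ i, Irreducible (p i)) ∧
      (∀ i, (p i).Monic) ∧ (∀ i, e i ≠ 0) ∧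
      Nonempty (M ≃ₗ[F[X]] ∀ i, F[X] ⧸ (Submodule.span F[X] {p i ^ e i})) := by
  classical
  obtain ⟨ι, _, p, hp, e, ⟨E⟩⟩ := Module.equiv_directSum_of_isTorsion hM
  refine ⟨{i // e i ≠ 0}, inferInstance, fun i => normalize (p i), fun i => e i, ?_, ?_,
    fun i => i.2, ⟨?_⟩⟩
  · intro i
    exact (normalize_associated (p i)).symm.irreducible (hp _)
  · intro i
    exact monic_normalize (hp _).ne_zero
  · have h1 : ∀ i, Submodule.span F[X] {p i ^ e i} = Submodule.span F[X] {normalize (p i) ^ e i} := by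
      intro i
      exact Ideal.span_singleton_eq_span_singleton.2 ((normalize_associated (p i)).symm.pow_pow)
    let φ : (∀ i, F[X] ⧸ (Submodule.span F[X] {p i ^ e i})) →ₗ[F[X]]
        (∀ i : {i // e i ≠ 0}, F[X] ⧸ (Submodule.span F[X] {normalize (p i) ^ e i})) :=
      LinearMap.pi fun i => (Submodule.quotEquivOfEq _ _ (h1 i.1)).toLinearMap ∘ₗ
        LinearMap.proj i.1
    have hφ : ∀ x i, φ x i = Submodule.quotEquivOfEq _ _ (h1 i.1) (x i.1) := fun x i => rfl
    refine E ≪≫ₗ (DirectSum.linearEquivFunOnFintype F[X] ι _) ≪≫ₗ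
      LinearEquiv.ofBijective φ ⟨?_, ?_⟩
    · rw [injective_iff_map_eq_zero]
      intro x hx
      funext i
      by_cases hi : e i = 0
      · obtain ⟨y, hy⟩ := Submodule.Quotient.mk_surjective _ (x i)
        rw [← hy, Pi.zero_apply, Submodule.Quotient.mk_eq_zero, hi]
        change _ ∈ Ideal.span _
        rw [Ideal.mem_span_singleton]
        simp
      · have := congrFun hx ⟨i, hi⟩
        rw [hφ, Pi.zero_apply, LinearEquiv.map_eq_zero_iff] at this
        exact this
    · intro y
      refine ⟨fun i => if h : e i ≠ 0 then
        (Submodule.quotEquivOfEq _ _ (h1 i)).symm (y ⟨i, h⟩) else 0, ?_⟩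
      funext i
      rw [hφ, dif_pos i.2]
      simp

lemma fk_key {α ι : Type*} [DecidableEq α] [Fintype ι] (p : ι → α) (e : ι → ℕ) (r : α) (m : ℕ) :
      Fintype.card {i // (p i, e i) = (r, m + 1)} + ∑ i, (if p i = r then min m (e i) else 0)
        + ∑ i, (if p i = r then min (m + 2) (e i) else 0) =
      2 * ∑ i, (if p i = r then min (m + 1) (e i) else 0) := by
    rw [Fintype.card_subtype, Finset.card_filter, ← Finset.sum_add_distrib,
      ← Finset.sum_add_distrib, Finset.mul_sum]
    refine Finset.sum_congr rfl fun i _ => ?_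
    by_cases h1 : p i = r
    · by_cases h2 : e i = m + 1
      · simp [h1, h2]; omega
      · simp [h1, h2]; omega
    · simp [h1]

lemma fk_count {α ι κ : Type*} [Fintype ι] [Fintype κ] [DecidableEq α]
    (p : ι → α) (e : ι → ℕ) (q : κ → α) (f : κ → ℕ) (he : ∀ i, e i ≠ 0) (hf : ∀ i, f i ≠ 0)
    (h : ∀ r, ((∃ i, p i = r) ∨ ∃ j, q j = r) → ∀ k,
      ∑ i, (if p i = r then min k (e i) else 0) = ∑ j, (if q j = r then min k (f j) else 0)) :
    ∃ σ : ι ≃ κ, ∀ i, p i = q (σ i) ∧ e i = f (σ i) := by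
  classical
  have hc : ∀ x : α × ℕ, Nonempty ({i // (p i, e i) = x} ≃ {j // (q j, f j) = x}) := by
    rintro ⟨r, m⟩
    rw [← Fintype.card_eq]
    by_cases hr : (∃ i, p i = r) ∨ ∃ j, q j = r
    · obtain _ | m := m
      · rw [Fintype.card_eq_zero_iff.2 ⟨fun i => he i.1 (Prod.ext_iff.1 i.2).2⟩,
          Fintype.card_eq_zero_iff.2 ⟨fun i => hf i.1 (Prod.ext_iff.1 i.2).2⟩]
      · have h1 := fk_key p e r m
        have h2 := fk_key q f r m
        rw [h r hr, h r hr, h r hr] at h1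
        omega
    · push Not at hr
      rw [Fintype.card_eq_zero_iff.2 ⟨fun i => hr.1 i.1 (Prod.ext_iff.1 i.2).1⟩,
        Fintype.card_eq_zero_iff.2 ⟨fun i => hr.2 i.1 (Prod.ext_iff.1 i.2).1⟩]
  let σ : ι ≃ κ := (Equiv.sigmaFiberEquiv (fun i => (p i, e i))).symm.trans
    ((Equiv.sigmaCongrRight fun x => (hc x).some).trans
      (Equiv.sigmaFiberEquiv (fun j => (q j, f j))))
  refine ⟨σ, fun i => ?_⟩
  have := ((hc (p i, e i)).some ⟨i, rfl⟩).2
  have h3 : (q (σ i), f (σ i)) = (p i, e i) := this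
  rw [Prod.mk.injEq] at h3
  exact ⟨h3.1.symm, h3.2.symm⟩

lemma fk_iso {F : Type*} [Field F] {M N : Type*}
    [AddCommGroup M] [Module F M] [Module F[X] M] [IsScalarTower F F[X] M]
    [AddCommGroup N] [Module F N] [Module F[X] N] [IsScalarTower F F[X] N]
    [Module.Finite F[X] M] [Module.Finite F[X] N]
    (hM : Module.IsTorsion F[X] M) (hN : Module.IsTorsion F[X] N)
    (h : ∀ p : F[X], p.Monic → Irreducible p → ∀ k : ℕ,
      finrank F (Submodule.torsionBy F[X] M (p ^ k)) =
      finrank F (Submodule.torsionBy F[X] N (p ^ k))) : Nonempty (M ≃ₗ[F[X]] N) := by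
  classical
  obtain ⟨ι, _, p, e, ip, mp, he, ⟨E⟩⟩ := fk_decomp M hM
  obtain ⟨κ, _, q, f, iq, mq, hf, ⟨E'⟩⟩ := fk_decomp N hN
  have fin : ∀ (p : F[X]) (e : ℕ), p.Monic →
      Module.Finite F (F[X] ⧸ (Submodule.span F[X] {p ^ e})) := by
    intro p e hp
    exact (hp.pow e).finite_quotient
  have := fun i => fin (p i) (e i) (mp i)
  have := fun i => fin (q i) (f i) (mq i)
  obtain ⟨σ, hσ⟩ := fk_count p e q f he hf (by
    intro r hr k
    have hr' : r.Monic ∧ Irreducible r := by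
      rcases hr with ⟨i, rfl⟩ | ⟨i, rfl⟩
      · exact ⟨mp i, ip i⟩
      · exact ⟨mq i, iq i⟩
    have h1 := h r hr'.1 hr'.2 k
    rw [fk_congr E, fk_congr E', fk_pi, fk_pi] at h1
    simp only [fk_quot r _ hr'.1 (mp _) hr'.2 (ip _), fk_quot r _ hr'.1 (mq _) hr'.2 (iq _)] at h1
    have h0 : 0 < r.natDegree := hr'.2.natDegree_pos
    refine Nat.eq_of_mul_eq_mul_right h0 ?_
    simpa [Finset.sum_mul, ite_mul] using h1)
  have A : (∀ i, F[X] ⧸ (Submodule.span F[X] {p i ^ e i})) ≃ₗ[F[X]]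
      (∀ i, F[X] ⧸ (Submodule.span F[X] {q (σ i) ^ f (σ i)})) :=
    LinearEquiv.piCongrRight fun i => Submodule.quotEquivOfEq _
      (Submodule.span F[X] {q (σ i) ^ f (σ i)}) (by rw [(hσ i).1, (hσ i).2])
  exact ⟨E ≪≫ₗ A ≪≫ₗ LinearEquiv.piCongrLeft F[X]
    (fun j => F[X] ⧸ (Submodule.span F[X] {q j ^ f j})) σ ≪≫ₗ E'.symm⟩

lemma fk_end {F : Type*} [Field F] {V : Type*} [AddCommGroup V] [Module F V] [FiniteDimensional F V]
    (f g : End F V)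
    (h : ∀ p : F[X], p.Monic → Irreducible p → ∀ k : ℕ,
      finrank F (LinearMap.ker (aeval f p ^ k)) = finrank F (LinearMap.ker (aeval g p ^ k))) :
    ∃ e : V ≃ₗ[F] V, ∀ x, e (f x) = g (e x) := by
  have tors : ∀ f : End F V, Module.IsTorsion F[X] (AEval' f) := by
    intro f x
    refine ⟨⟨minpoly F f, mem_nonZeroDivisors_of_ne_zero
      (minpoly.ne_zero (Algebra.IsIntegral.isIntegral f))⟩, ?_⟩
    apply (AEval'.of f).symm.injective
    change (AEval.of F V f).symm (minpoly F f • x) = _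
    rw [AEval.of_symm_smul, minpoly.aeval]
    simp
  have dims : ∀ (f : End F V) (p : F[X]), finrank F (Submodule.torsionBy F[X] (AEval' f) p) =
      finrank F (LinearMap.ker (aeval f p)) := by
    intro f p
    refine LinearEquiv.finrank_eq
      { toFun := fun x => ⟨x.1, x.2⟩
        invFun := fun x => ⟨x.1, x.2⟩
        map_add' := fun x y => rfl
        map_smul' := fun a x => rfl
        left_inv := fun x => rfl
        right_inv := fun x => rfl }
  obtain ⟨E⟩ := fk_iso (F := F) (tors f) (tors g) (by
    intro p hp ip k
    rw [dims, dims, map_pow, map_pow, h p hp ip k])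
  refine ⟨(AEval'.of f).trans ((E.restrictScalars F).trans (AEval'.of g).symm), fun x => ?_⟩
  have := E.map_smul X (AEval'.of f x)
  rw [AEval'.X_smul_of] at this
  change (AEval'.of g).symm (E (AEval'.of f (f x))) = _
  rw [this]
  exact AEval.of_symm_X_smul _ _

lemma fk_reflect {F A : Type*} [Field F] [Ring A] [Algebra F A] (T T' : A) (h : T * T' = 1)
    (N : ℕ) (g : F[X]) (hg : g.natDegree ≤ N) :
    aeval T (reflect N g) = T ^ N * aeval T' g := by
  refine induction_with_natDegree_le
    (fun g => aeval T (reflect N g) = T ^ N * aeval T' g) N ?_ ?_ ?_ g hg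
  · simp
  · intro n r _ hn
    rw [reflect_C_mul_X_pow, revAt_le hn]
    obtain ⟨m, rfl⟩ := Nat.exists_eq_add_of_le' hn
    have hp : ∀ n : ℕ, T ^ n * T' ^ n = 1 := by
      intro n
      induction n with
      | zero => simp
      | succ n ih => rw [pow_succ, pow_succ', mul_assoc, ← mul_assoc T T', h, one_mul, ih]
    simp only [map_mul, aeval_C, aeval_X_pow, Nat.add_sub_cancel_right]
    rw [← mul_assoc, ← Algebra.commutes r (T ^ (m + n)), mul_assoc, pow_add, mul_assoc, hp, mul_one]
  · intro f g _ _ hf hg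
    rw [reflect_add, map_add, hf, hg, map_add, mul_add]

lemma fk_ker_map {F : Type*} [Field F] (c : F →+* F) (hc : ∀ x, c (c x) = x) {n : ℕ}
    (A : Matrix (Fin n) (Fin n) F) :
    finrank F (LinearMap.ker A.mulVecLin) = finrank F (LinearMap.ker (A.map c).mulVecLin) := by
  have hb : Function.Bijective c := Function.Involutive.bijective hc
  have hm : ∀ (B : Matrix (Fin n) (Fin n) F) (v : Fin n → F), B *ᵥ v = 0 →
      (B.map c) *ᵥ (fun i => c (v i)) = 0 := by
    intro B v h
    funext i
    have := congrArg c (congrFun h i)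
    rw [RingHom.map_mulVec] at this
    simpa [Function.comp_def] using this
  have hcc : (A.map c).map c = A := by ext i j; simp [hc]
  unfold finrank
  congr 1
  refine rank_eq_of_equiv_equiv c
    { toFun := fun x => ⟨fun i => c (x.1 i), hm A x.1 x.2⟩
      invFun := fun x => ⟨fun i => c (x.1 i), by
        have := hm (A.map c) x.1 x.2
        rwa [hcc] at this⟩
      left_inv := fun x => by ext i; simp [hc]
      right_inv := fun x => by ext i; simp [hc]
      map_add' := fun x y => by ext i; simp } hb ?_
  intro r m
  ext i
  simp

lemma fk_ker_unit {F : Type*} [Field F] {n : ℕ}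
    (B A : Matrix (Fin n) (Fin n) F) (hB : IsUnit B) :
    LinearMap.ker (B * A).mulVecLin = LinearMap.ker A.mulVecLin := by
  ext v
  simp only [LinearMap.mem_ker, mulVecLin_apply]
  rw [← mulVec_mulVec]
  constructor
  · intro h
    exact Matrix.mulVec_injective_of_isUnit hB (by rw [h, mulVec_zero])
  · intro h
    rw [h, mulVec_zero]

lemma fk_dual {F : Type*} [Field F] (c : F →+* F) (hc : ∀ x, c (c x) = x)
    (n : ℕ) (T : Matrix (Fin n) (Fin n) F) (hT : IsUnit T) (p : F[X]) (h0 : p.coeff 0 ≠ 0) (k : ℕ) :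
    finrank F (LinearMap.ker ((aeval T (dualPoly c p) ^ k).mulVecLin)) =
    finrank F (LinearMap.ker ((aeval (T.map c)⁻¹ p ^ k).mulVecLin)) := by
  have hd : IsUnit T.det := (Matrix.isUnit_iff_isUnit_det T).1 hT
  have h1 : T * T⁻¹ = 1 := Matrix.mul_nonsing_inv T hd
  have h2 : T⁻¹ * T = 1 := Matrix.nonsing_inv_mul T hd
  have hU : (T.map c)⁻¹ = T⁻¹.map c := by
    apply Matrix.inv_eq_right_inv
    rw [← Matrix.map_mul, h1]
    exact Matrix.map_one c (map_zero c) (map_one c)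
  have hV : (T⁻¹.map c).map c = T⁻¹ := by ext i j; simp [hc]
  have hmap : (aeval (T.map c)⁻¹ p).map c = aeval T⁻¹ (p.map c) := by
    rw [hU]
    have := hom_eval₂ p (algebraMap F (Matrix (Fin n) (Fin n) F)) c.mapMatrix (T⁻¹.map c)
    rw [RingHom.mapMatrix_apply, RingHom.mapMatrix_apply, hV] at this
    rw [aeval_def, this, aeval_def, eval₂_map]
    congr 1
    ext r i j
    simp [Matrix.algebraMap_matrix_apply, apply_ite c]
  have hcomm : Commute T (aeval T⁻¹ (p.map c)) := by
    have : Commute T T⁻¹ := by rw [Commute, SemiconjBy, h1, h2]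
    induction p.map c using Polynomial.induction_on' with
    | add p q hp hq => rw [map_add]; exact hp.add_right hq
    | monomial m a =>
      rw [aeval_monomial]
      exact (Algebra.commute_algebraMap_right a T).mul_right (this.pow_right m)
  rw [fk_ker_map c hc (aeval (T.map c)⁻¹ p ^ k)]
  have : (aeval (T.map c)⁻¹ p ^ k).map c = aeval T⁻¹ (p.map c) ^ k := by
    rw [← hmap]
    exact map_pow c.mapMatrix _ _
  rw [this]
  have h3 : aeval T (dualPoly c p) =
      ((c (p.coeff 0))⁻¹ • T ^ (p.map c).natDegree) * aeval T⁻¹ (p.map c) := by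
    rw [dualPoly, map_smul, reverse, fk_reflect T T⁻¹ h1 _ _ le_rfl, smul_mul_assoc]
  rw [h3, Commute.mul_pow, fk_ker_unit]
  · apply IsUnit.pow
    have hz : (c (p.coeff 0))⁻¹ ≠ 0 := inv_ne_zero ((map_ne_zero c).2 h0)
    exact (hT.pow _).smul (Units.mk0 _ hz)
  · exact (hcomm.pow_left _).smul_left _

theorem c_real_iff_self_dual_elementary_divisors
    {F : Type*} [Field F] (c : F →+* F) (hc : ∀ x, c (c x) = x)
    (n : ℕ) (hn : 2 ≤ n)
    (T : Matrix (Fin n) (Fin n) F) (hT : IsUnit T) :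
    (∃ S : Matrix (Fin n) (Fin n) F, IsUnit S ∧ S * T * S⁻¹ = (T.map c)⁻¹) ↔
    (∀ p : Polynomial F, p.Monic → Irreducible p → p ≠ X → ∀ k : ℕ, 1 ≤ k →
      finrank F (LinearMap.ker ((aeval T p ^ k).mulVecLin)) =
        finrank F (LinearMap.ker ((aeval T (dualPoly c p) ^ k).mulVecLin))) := by
  have hcoeff : ∀ p : F[X], p.Monic → Irreducible p → p ≠ X → p.coeff 0 ≠ 0 := by
    intro p mp ip hX h0
    exact hX (eq_of_monic_of_associated monic_X mp
      (irreducible_X.associated_of_dvd ip (X_dvd_iff.2 h0))).symm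
  constructor
  · rintro ⟨S, hS, hST⟩ p mp ip hX k -
    rw [fk_dual c hc n T hT p (hcoeff p mp ip hX), ← hST]
    have hd : IsUnit S.det := (Matrix.isUnit_iff_isUnit_det S).1 hS
    have h1 : S * S⁻¹ = 1 := Matrix.mul_nonsing_inv S hd
    have h2 : S⁻¹ * S = 1 := Matrix.nonsing_inv_mul S hd
    have hsemi : ∀ q : F[X], S * aeval T q = aeval (S * T * S⁻¹) q * S := by
      intro q
      induction q using Polynomial.induction_on' with
      | add p q hp hq => rw [map_add, map_add, mul_add, add_mul, hp, hq]
      | monomial m a =>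
        have : SemiconjBy S T (S * T * S⁻¹) := by
          rw [SemiconjBy, mul_assoc, mul_assoc, h2, mul_one]
        rw [aeval_monomial, aeval_monomial, mul_assoc, ← (this.pow_right m).eq, ← mul_assoc,
          ← mul_assoc, Algebra.commutes a S]
    have hk := hsemi (p ^ k)
    rw [map_pow, map_pow] at hk
    rw [← fk_ker_unit S _ hS, hk]
    have key : ∀ B : Matrix (Fin n) (Fin n) F,
        LinearMap.ker (B * S).mulVecLin =
        (LinearMap.ker B.mulVecLin).comap S.mulVecLin := by
      intro B
      rw [Matrix.mulVecLin_mul]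
      rfl
    rw [key]
    let e : (Fin n → F) ≃ₗ[F] (Fin n → F) := LinearEquiv.ofBijective S.mulVecLin
      ((Function.bijective_iff_has_inverse).2 ⟨S⁻¹.mulVecLin,
        fun v => by simp [mulVec_mulVec, h2], fun v => by simp [mulVec_mulVec, h1]⟩)
    have h5 := LinearEquiv.finrank_map_eq e.symm
      (LinearMap.ker (aeval (S * T * S⁻¹) p ^ k).mulVecLin)
    rw [← h5, ← Submodule.comap_equiv_eq_map_symm e]
    rfl
  · intro h
    have toL : ∀ (A : Matrix (Fin n) (Fin n) F) (q : F[X]),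
        aeval (Matrix.toLin' A) q = (aeval A q).mulVecLin := by
      intro A q
      exact aeval_algHom_apply (Matrix.toLinAlgEquiv' (R := F) (n := Fin n)).toAlgHom A q
    obtain ⟨e, he⟩ := fk_end (Matrix.toLin' T) (Matrix.toLin' (T.map c)⁻¹) (by
      intro p mp ip k
      rw [← map_pow, ← map_pow, toL, toL, map_pow, map_pow]
      obtain rfl | hk := Nat.eq_zero_or_pos k
      · rw [pow_zero, pow_zero]
      by_cases hX : p = X
      · subst hX
        rw [aeval_X, aeval_X]
        have hd : IsUnit T.det := (Matrix.isUnit_iff_isUnit_det T).1 hT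
        have hU : IsUnit (T.map c)⁻¹ := by
          rw [Matrix.isUnit_nonsing_inv_iff]
          exact hT.map c.mapMatrix
        have h1 := fk_ker_unit (T ^ k) 1 (hT.pow k)
        have h2 := fk_ker_unit ((T.map c)⁻¹ ^ k) 1 (hU.pow k)
        rw [mul_one] at h1 h2
        rw [h1, h2]
      · rw [h p mp ip hX k hk, fk_dual c hc n T hT p (hcoeff p mp ip hX)])
    let S := LinearMap.toMatrix' e.toLinearMap
    let S' := LinearMap.toMatrix' e.symm.toLinearMap
    have h1 : S * S' = 1 := by
      rw [← LinearMap.toMatrix'_comp]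
      simp
    have h2 : S' * S = 1 := by
      rw [← LinearMap.toMatrix'_comp]
      simp
    refine ⟨S, ⟨⟨S, S', h1, h2⟩, rfl⟩, ?_⟩
    rw [Matrix.inv_eq_right_inv h1]
    have h3 : S * T = (T.map c)⁻¹ * S := by
      apply Matrix.toLin'.injective
      rw [Matrix.toLin'_mul, Matrix.toLin'_mul, Matrix.toLin'_toMatrix']
      exact LinearMap.ext he
    rw [h3, mul_assoc, h1, mul_one]
end

section
/- Let F be a field with an involution c, let T ∈ GL_n(F) be an invertible matrix, let p be a monic polynomial over F with p(0) ≠ 0, and let k ≥ 1. Then dim_F ker ( p((T^c)^{-1})^k ) = dim_F ker ( p*(T)^k ), where p* is the dual polynomial of p. (This expresses that the elementary divisors of (T^c)^{-1} are the duals of the elementary divisors of T.) -/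
open Matrix Polynomial Module

/-- Evaluating the reverse polynomial at an invertible element. -/
theorem aeval_reverse_eq_pow_mul {F A : Type*} [Field F] [Ring A] [Algebra F A] (T S : A)
    (h : T * S = 1) (f : Polynomial F) :
    aeval T f.reverse = T ^ f.natDegree * aeval S f := by
  have key : ∀ i j : ℕ, T ^ (i + j) * S ^ j = T ^ i := by
    intro i j
    induction j with
    | zero => simp
    | succ j ih =>
      rw [← add_assoc, pow_succ, pow_succ', mul_assoc, ← mul_assoc T S, h, one_mul, ih]
  rw [aeval_eq_sum_range' (Nat.lt_succ_of_le f.reverse_natDegree_le), aeval_eq_sum_range,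
    Finset.mul_sum, ← Finset.sum_range_reflect]
  refine Finset.sum_congr rfl fun j hj => ?_
  have hj' : j ≤ f.natDegree := Nat.lt_succ_iff.mp (Finset.mem_range.mp hj)
  have e : f.natDegree.succ - 1 - j = f.natDegree - j := by simp
  rw [e, coeff_reverse, revAt_le (Nat.sub_le _ _), Nat.sub_sub_self hj', mul_smul_comm]
  congr 1
  rw [← key (f.natDegree - j) j, Nat.sub_add_cancel hj']

/-- Applying a field endomorphism entrywise to a polynomial in a matrix. -/
theorem mapMatrix_aeval {F : Type*} [Field F] (c : F →+* F) {n : ℕ}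
    (S : Matrix (Fin n) (Fin n) F) (p : Polynomial F) :
    c.mapMatrix (aeval S p) = aeval (c.mapMatrix S) (p.map c) := by
  rw [aeval_eq_sum_range, aeval_eq_sum_range, map_sum, natDegree_map]
  refine Finset.sum_congr rfl fun j _ => ?_
  rw [coeff_map, ← map_pow]
  ext a b
  simp [Matrix.map_apply]

/-- `p*(T)^k` is a unit times the conjugate of `p((T^c)⁻¹)^k`. -/
theorem aeval_dualPoly_pow {F : Type*} [Field F] (c : F →+* F) (hc : ∀ x, c (c x) = x)
    (n : ℕ) (T : Matrix (Fin n) (Fin n) F) (hT : IsUnit T)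
    (p : Polynomial F) (h0 : p.coeff 0 ≠ 0) (k : ℕ) :
    ∃ U : Matrix (Fin n) (Fin n) F, IsUnit U ∧
      aeval T (dualPoly c p) ^ k = U * c.mapMatrix (aeval (T.map c)⁻¹ p ^ k) := by
  have hcc : c.mapMatrix (T.map c) = T := by
    ext i j
    simp [hc]
  have hTc : IsUnit (T.map c) := hT.map c.mapMatrix
  have h1 : T * c.mapMatrix (T.map c)⁻¹ = 1 := by
    have := congrArg c.mapMatrix
      (Matrix.mul_nonsing_inv (T.map c) ((Matrix.isUnit_iff_isUnit_det _).mp hTc))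
    rwa [map_mul, hcc, map_one] at this
  have h2 : aeval T (dualPoly c p) =
      ((c (p.coeff 0))⁻¹ • T ^ (p.map c).natDegree) * c.mapMatrix (aeval (T.map c)⁻¹ p) := by
    rw [dualPoly, map_smul, aeval_reverse_eq_pow_mul T _ h1, mapMatrix_aeval, smul_mul_assoc]
  have h3 : Commute T (c.mapMatrix (aeval (T.map c)⁻¹ p)) := by
    rw [mapMatrix_aeval]
    have h4 : Commute T (c.mapMatrix (T.map c)⁻¹) := by
      rw [Commute, SemiconjBy, h1]
      exact (mul_eq_one_comm.mp h1).symm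
    rw [aeval_eq_sum_range]
    exact Commute.sum_right _ _ _ fun j _ => (h4.pow_right j).smul_right _
  refine ⟨((c (p.coeff 0))⁻¹ • T ^ (p.map c).natDegree) ^ k, ?_, ?_⟩
  · have hne : (c (p.coeff 0))⁻¹ ≠ 0 := inv_ne_zero ((map_ne_zero c).mpr h0)
    refine IsUnit.pow k ?_
    exact (hT.pow _).smul (Units.mk0 _ hne)
  · rw [h2, ((h3.pow_left _).smul_left _).mul_pow, map_pow]

/-- Let `F` be a field with an involution `c`, `T ∈ GL_n(F)`, `p` monic with
`p(0) ≠ 0`, and `k ≥ 1`. Then `dim ker (p((T^c)⁻¹)^k) = dim ker (p*(T)^k)`: the elementary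
divisors of `(T^c)⁻¹` are the duals of those of `T`. -/
theorem elementary_divisors_of_c_inverse_are_dual
    {F : Type*} [Field F] (c : F →+* F) (hc : ∀ x, c (c x) = x)
    (n : ℕ) (T : Matrix (Fin n) (Fin n) F) (hT : IsUnit T)
    (p : Polynomial F) (hmonic : p.Monic) (h0 : p.coeff 0 ≠ 0)
    (k : ℕ) (hk : 1 ≤ k) :
    finrank F (LinearMap.ker ((aeval (T.map c)⁻¹ p ^ k).mulVecLin)) =
      finrank F (LinearMap.ker ((aeval T (dualPoly c p) ^ k).mulVecLin)) := by
  obtain ⟨U, ⟨u, rfl⟩, hU⟩ := aeval_dualPoly_pow c hc n T hT p h0 k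
  rw [hU]
  generalize aeval (T.map c)⁻¹ p ^ k = A
  have hbij : Function.Bijective c := ⟨c.injective, fun x => ⟨c x, hc x⟩⟩
  have hker : ∀ v : Fin n → F, (u.1 * c.mapMatrix A) *ᵥ v = 0 ↔ c.mapMatrix A *ᵥ v = 0 := by
    intro v
    rw [← Matrix.mulVec_mulVec]
    refine ⟨fun h => ?_, fun h => by rw [h, Matrix.mulVec_zero]⟩
    have := congrArg (fun w => (↑u⁻¹ : Matrix (Fin n) (Fin n) F) *ᵥ w) h
    simpa only [Matrix.mulVec_mulVec, ← mul_assoc, Units.inv_mul, one_mul,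
      Matrix.mulVec_zero] using this
  have hmap : ∀ v : Fin n → F, c.mapMatrix A *ᵥ (c ∘ v) = c ∘ (A *ᵥ v) := by
    intro v
    ext i
    simp [Matrix.mulVec, dotProduct]
  have hinv : ∀ v : Fin n → F, c ∘ (c ∘ v) = v := fun v => funext fun i => hc (v i)
  have hz : ∀ v : Fin n → F, c ∘ v = 0 ↔ v = 0 := by
    intro v
    simp [funext_iff]
  have hmem : ∀ v : Fin n → F, (c ∘ v) ∈ LinearMap.ker ((u.1 * c.mapMatrix A).mulVecLin) ↔
      v ∈ LinearMap.ker A.mulVecLin := by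
    intro v
    rw [LinearMap.mem_ker, LinearMap.mem_ker, Matrix.mulVecLin_apply, Matrix.mulVecLin_apply,
      hker, hmap, hz]
  let j : LinearMap.ker A.mulVecLin ≃+ LinearMap.ker ((u.1 * c.mapMatrix A).mulVecLin) :=
    { toFun := fun v => ⟨c ∘ v.1, (hmem v.1).mpr v.2⟩
      invFun := fun v => ⟨c ∘ v.1, (hmem _).mp (by rw [hinv]; exact v.2)⟩
      left_inv := fun v => Subtype.ext (hinv v.1)
      right_inv := fun v => Subtype.ext (hinv v.1)
      map_add' := fun v w => Subtype.ext (funext fun i => map_add c (v.1 i) (w.1 i)) }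
  refine congrArg Cardinal.toNat (rank_eq_of_equiv_equiv c j hbij ?_)
  intro r v
  exact Subtype.ext (funext fun i => map_mul c r (v.1 i))
end
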